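/- arXiv:1102.4552 — 7 statements merged into one kernel-verified Lean document; each statement's English description precedes it below -/
import Mathlib

section
/- Let n ≥ 1 and let a, b, c, d ∈ ℤ/nℤ be such that the matrix A = [[a,b],[c,d]] has unit determinant ad − bc. Then the following two conditions are equivalent: (i) for every pair (α,β) ∈ (ℤ/nℤ)² with (α,β) ≠ (0,0) and satisfying α = 0 or β = 0 or α = β, one has aα + bβ ≠ 0, cα + dβ ≠ 0, and aα + bβ ≠ cα + dβ; (ii) each of the nine elements a, b, c, d, a+b, c+d, a−c, b−d, a+b−c−d is a unit of ℤ/nℤ. -/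
theorem isUnit_iff_forall_mul_ne_zero {R : Type*} [CommRing R] [Finite R] (x : R) :
    IsUnit x ↔ ∀ y : R, y ≠ 0 → x * y ≠ 0 := by
  rw [isUnit_iff_mem_nonZeroDivisors_of_finite, mem_nonZeroDivisors_iff_right]
  refine forall_congr' fun y => ?_
  rw [mul_comm y x, ← not_imp_not]


/-- For a matrix `A = [[a,b],[c,d]]` over `ℤ/nℤ` with unit determinant,
the free-action condition (i) is equivalent to the nine-units condition (ii). -/
theorem freeAction_iff_units (n : ℕ) (hn : 1 ≤ n) (a b c d : ZMod n)
    (hdet : IsUnit (a * d - b * c)) :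
    (∀ α β : ZMod n, (α, β) ≠ (0, 0) → (α = 0 ∨ β = 0 ∨ α = β) →
        a * α + b * β ≠ 0 ∧ c * α + d * β ≠ 0 ∧ a * α + b * β ≠ c * α + d * β) ↔
    (IsUnit a ∧ IsUnit b ∧ IsUnit c ∧ IsUnit d ∧ IsUnit (a + b) ∧ IsUnit (c + d) ∧
      IsUnit (a - c) ∧ IsUnit (b - d) ∧ IsUnit (a + b - c - d)) := by
  have : NeZero n := ⟨by omega⟩
  simp only [isUnit_iff_forall_mul_ne_zero]
  constructor
  · intro h
    have h₁ (y : ZMod n) (hy : y ≠ 0) := h y 0 (by simp [hy]) (by simp)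
    have h₂ (y : ZMod n) (hy : y ≠ 0) := h 0 y (by simp [hy]) (by simp)
    have h₃ (y : ZMod n) (hy : y ≠ 0) := h y y (by simp [hy]) (by simp)
    simp only [mul_zero, add_zero] at h₁
    simp only [mul_zero, zero_add] at h₂
    refine ⟨fun y hy => (h₁ y hy).1, fun y hy => (h₂ y hy).1, fun y hy => (h₁ y hy).2.1,
      fun y hy => (h₂ y hy).2.1, fun y hy => ?_, fun y hy => ?_, fun y hy => ?_,
      fun y hy => ?_, fun y hy => ?_⟩
    · rw [add_mul]; exact (h₃ y hy).1
    · rw [add_mul]; exact (h₃ y hy).2.1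
    · rw [sub_mul, sub_ne_zero]; exact (h₁ y hy).2.2
    · rw [sub_mul, sub_ne_zero]; exact (h₂ y hy).2.2
    · rw [sub_sub, sub_mul, sub_ne_zero, add_mul, add_mul]; exact (h₃ y hy).2.2
  · rintro ⟨ha, hb, hc, hd, hab, hcd, hac, hbd, habcd⟩ α β hne (rfl | rfl | rfl)
    · have hβ : β ≠ 0 := by simpa using hne
      simp only [mul_zero, zero_add]
      refine ⟨hb β hβ, hd β hβ, ?_⟩
      rw [← sub_ne_zero, ← sub_mul]
      exact hbd β hβ
    · have hα : α ≠ 0 := by simpa using hne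
      simp only [mul_zero, add_zero]
      refine ⟨ha α hα, hc α hα, ?_⟩
      rw [← sub_ne_zero, ← sub_mul]
      exact hac α hα
    · have hα : α ≠ 0 := by simpa using hne
      rw [← add_mul, ← add_mul]
      refine ⟨hab α hα, hcd α hα, ?_⟩
      rw [← sub_ne_zero, ← sub_mul, ← sub_sub]
      exact habcd α hα
end

section
/- Let n ≥ 1. If there exist a, b, c, d ∈ ℤ/nℤ such that ad − bc is a unit and each of a, b, c, d, a+b, c+d, a−c, b−d, a+b−c−d is a unit of ℤ/nℤ, then n is coprime to 6. -/
/-- In `ℤ/2ℤ` two nonzero elements sum to zero. -/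
lemma ZMod.add_eq_zero_two :
    ∀ a b : ZMod 2, a ≠ 0 → b ≠ 0 → a + b = 0 := by
  decide

/-- In `ℤ/3ℤ` two nonzero elements with nonzero sum are equal. -/
lemma ZMod.eq_of_add_ne_zero_three :
    ∀ a b : ZMod 3, a ≠ 0 → b ≠ 0 → a + b ≠ 0 → a = b := by
  decide

/-- If `ℤ/nℤ` contains elements `a, b, c, d` with `ad - bc` a unit and all of
`a, b, c, d, a+b, c+d, a-c, b-d, a+b-c-d` units, then `n` is coprime to `6`. -/
theorem coprime_six_of_units (n : ℕ) (hn : 1 ≤ n)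
    (h : ∃ a b c d : ZMod n, IsUnit (a * d - b * c) ∧
      IsUnit a ∧ IsUnit b ∧ IsUnit c ∧ IsUnit d ∧ IsUnit (a + b) ∧ IsUnit (c + d) ∧
      IsUnit (a - c) ∧ IsUnit (b - d) ∧ IsUnit (a + b - c - d)) :
    Nat.Coprime n 6 := by
  obtain ⟨a, b, c, d, hdet, ha, hb, hc, hd, hab, hcd, -⟩ := h
  have h2 : Nat.Coprime n 2 := by
    refine ((Nat.Prime.coprime_iff_not_dvd Nat.prime_two).2 fun hdvd ↦ ?_).symm
    let f := ZMod.castHom hdvd (ZMod 2)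
    refine (hab.map f).ne_zero ?_
    rw [map_add]
    exact ZMod.add_eq_zero_two _ _ (ha.map f).ne_zero (hb.map f).ne_zero
  have h3 : Nat.Coprime n 3 := by
    refine ((Nat.Prime.coprime_iff_not_dvd Nat.prime_three).2 fun hdvd ↦ ?_).symm
    let f := ZMod.castHom hdvd (ZMod 3)
    have hfab : f a = f b := ZMod.eq_of_add_ne_zero_three _ _ (ha.map f).ne_zero
      (hb.map f).ne_zero (map_add f a b ▸ (hab.map f).ne_zero)
    have hfcd : f c = f d := ZMod.eq_of_add_ne_zero_three _ _ (hc.map f).ne_zero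
      (hd.map f).ne_zero (map_add f c d ▸ (hcd.map f).ne_zero)
    refine (hdet.map f).ne_zero ?_
    rw [map_sub, map_mul, map_mul, hfab, hfcd, sub_self]
  exact h2.mul_right h3
end

section
/- Let p be a prime and e ≥ 1. Then the cardinality of 𝔉_{p^e} equals p^{4e−4}·(p−1)(p−2)(p−3)(p−4). -/
open Matrix

/-- `𝔉ₙ`: matrices `A = [[a,b],[c,d]]` over `ℤ/nℤ` with unit determinant `ad - bc` and with
`a, b, c, d, a+b, c+d, a-c, b-d, a+b-c-d` all units of `ℤ/nℤ`. -/
def Frak (n : ℕ) (A : Matrix (Fin 2) (Fin 2) (ZMod n)) : Prop :=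
  IsUnit (A 0 0 * A 1 1 - A 0 1 * A 1 0) ∧
  IsUnit (A 0 0) ∧ IsUnit (A 0 1) ∧ IsUnit (A 1 0) ∧ IsUnit (A 1 1) ∧
  IsUnit (A 0 0 + A 0 1) ∧ IsUnit (A 1 0 + A 1 1) ∧
  IsUnit (A 0 0 - A 1 0) ∧ IsUnit (A 0 1 - A 1 1) ∧
  IsUnit (A 0 0 + A 0 1 - A 1 0 - A 1 1)

theorem AddMonoidHom.card_preimage_of_surjective {G H : Type*} [AddGroup G] [AddGroup H]
    (f : G →+ H) (hf : Function.Surjective f) (t : Set H) :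
    Nat.card (f ⁻¹' t) = Nat.card f.ker * Nat.card t := by
  let φ := QuotientAddGroup.quotientKerEquivOfSurjective f hf
  have h : f ⁻¹' t = (QuotientAddGroup.mk : G → G ⧸ f.ker) ⁻¹' (φ ⁻¹' t) := rfl
  rw [h, Nat.card_congr (QuotientAddGroup.preimageMkEquivAddSubgroupProdSet _ _), Nat.card_prod,
    Nat.card_preimage_of_injective φ.injective (by simp [φ.surjective.range_eq])]

theorem ZMod.isUnit_castHom_pow_iff {p e : ℕ} [NeZero p] (he : e ≠ 0) (x : ZMod (p ^ e)) :
    IsUnit (ZMod.castHom (dvd_pow_self p he) (ZMod p) x) ↔ IsUnit x := by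
  obtain ⟨k, rfl⟩ := ZMod.natCast_zmod_surjective x
  rw [map_natCast, ZMod.isUnit_iff_coprime, ZMod.isUnit_iff_coprime,
    Nat.coprime_pow_right_iff (Nat.pos_of_ne_zero he)]

theorem Frak_map_castHom_iff {p e : ℕ} [NeZero p] (he : e ≠ 0)
    (A : Matrix (Fin 2) (Fin 2) (ZMod (p ^ e))) :
    Frak p (A.map (ZMod.castHom (dvd_pow_self p he) (ZMod p))) ↔ Frak (p ^ e) A := by
  simp only [Frak, Matrix.map_apply, ← map_mul, ← map_add, ← map_sub,
    ZMod.isUnit_castHom_pow_iff he]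

theorem card_Frak_pow {p e : ℕ} [NeZero p] (he : e ≠ 0) :
    Nat.card {A : Matrix (Fin 2) (Fin 2) (ZMod (p ^ e)) // Frak (p ^ e) A} =
      p ^ (4 * e - 4) * Nat.card {A : Matrix (Fin 2) (Fin 2) (ZMod p) // Frak p A} := by
  let f : Matrix (Fin 2) (Fin 2) (ZMod (p ^ e)) →+ Matrix (Fin 2) (Fin 2) (ZMod p) :=
    (ZMod.castHom (dvd_pow_self p he) (ZMod p)).toAddMonoidHom.mapMatrix
  have hf : Function.Surjective f :=
    (ZMod.castHom_surjective (dvd_pow_self p he)).comp_left.comp_left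
  have hpre : f ⁻¹' {A | Frak p A} = {A | Frak (p ^ e) A} :=
    Set.ext (Frak_map_castHom_iff he)
  have hker : Nat.card f.ker = p ^ (4 * e - 4) := by
    have h := f.card_preimage_of_surjective hf Set.univ
    have h4 : p ^ (4 * e) = p ^ (4 * e - 4) * p ^ 4 := by
      rw [← pow_add]; congr 1; omega
    simp only [Set.preimage_univ, Nat.card_univ] at h
    simp only [Matrix, Nat.card_fun, Nat.card_zmod, Nat.card_fin, ← pow_mul, mul_assoc,
      Nat.reduceMul] at h
    refine Nat.eq_of_mul_eq_mul_right (pow_pos (NeZero.pos p) 4) ?_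
    rw [← h4, mul_comm 4 e]
    exact h.symm
  have h := f.card_preimage_of_surjective hf {A | Frak p A}
  rw [hpre, hker] at h
  exact h

section Field

variable {F : Type*} [Field F] [DecidableEq F]

theorem card_forbidden_corner {a b c : F} (ha : a ≠ 0) (hb : b ≠ 0) (hab : b ≠ -a) (hc : c ≠ 0)
    (hac : c ≠ a) :
    (({0, -c, b, a + b - c, b * c / a} : Finset F).card : ℤ) =
      5 - (if c = a + b then 1 else 0) - (if c = -b then 1 else 0) := by
  have h₁ : (0 : F) ≠ -c := by grind
  have h₂ : -c ≠ a + b - c := by grind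
  have h₃ : -c ≠ b * c / a := by
    intro h; field_simp at h; grind
  have h₄ : b ≠ a + b - c := by grind
  have h₅ : b ≠ b * c / a := by
    intro h; field_simp at h; grind
  have h₆ : a + b - c ≠ b * c / a := by
    intro h; field_simp at h
    have : (a + b) * (a - c) = 0 := by linear_combination h
    grind
  have h₇ : (0 : F) ≠ b * c / a := by positivity
  have e₁ : (0 : F) = a + b - c ↔ c = a + b := by grind
  have e₂ : -c = b ↔ c = -b := by grind
  simp only [Finset.card_insert_eq_ite, Finset.mem_insert, Finset.mem_singleton,
    Finset.card_singleton, h₁, h₂, h₃, h₄, h₅, h₆, h₇, hb.symm, e₁, e₂, or_false, false_or,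
    if_false]
  split_ifs <;> norm_num

variable [Fintype F]

/-- The number of admissible entries `b`, `c`, `d` of a matrix over a finite field whose upper left
entry is `a`. -/
theorem sum_card_corner {a : F} (ha : a ≠ 0) :
    ∑ b ∈ ({0, -a} : Finset F)ᶜ, ∑ c ∈ ({0, a} : Finset F)ᶜ,
      (({0, -c, b, a + b - c, b * c / a} : Finset F)ᶜ.card : ℤ) =
    (Fintype.card F - 2) * (Fintype.card F - 3) * (Fintype.card F - 4) := by
  have hpair {x : F} (hx : x ≠ 0) :
      ((({0, x} : Finset F)ᶜ.card : ℕ) : ℤ) = Fintype.card F - 2 := by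
    rw [Finset.card_compl, Nat.cast_sub (Finset.card_le_univ _), Finset.card_pair hx.symm]
    rfl
  have hinner (b) (hb : b ∈ ({0, -a} : Finset F)ᶜ) : ∑ c ∈ ({0, a} : Finset F)ᶜ,
      (({0, -c, b, a + b - c, b * c / a} : Finset F)ᶜ.card : ℤ) =
      (Fintype.card F - 2) * (Fintype.card F - 5) + 2 := by
    simp only [Finset.mem_compl, Finset.mem_insert, Finset.mem_singleton, not_or] at hb
    have hterm (c) (hc : c ∈ ({0, a} : Finset F)ᶜ) :
        (({0, -c, b, a + b - c, b * c / a} : Finset F)ᶜ.card : ℤ) = (Fintype.card F - 5) +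
          ((if c = a + b then 1 else 0) + (if c = -b then 1 else 0)) := by
      simp only [Finset.mem_compl, Finset.mem_insert, Finset.mem_singleton, not_or] at hc
      rw [Finset.card_compl, Nat.cast_sub (Finset.card_le_univ _),
        card_forbidden_corner ha hb.1 hb.2 hc.1 hc.2]
      ring
    have m₁ : a + b ∈ ({0, a} : Finset F)ᶜ := by
      simp only [Finset.mem_compl, Finset.mem_insert, Finset.mem_singleton]; grind
    have m₂ : -b ∈ ({0, a} : Finset F)ᶜ := by
      simp only [Finset.mem_compl, Finset.mem_insert, Finset.mem_singleton]; grind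
    rw [Finset.sum_congr rfl hterm, Finset.sum_add_distrib, Finset.sum_add_distrib,
      Finset.sum_ite_eq', Finset.sum_ite_eq', if_pos m₁, if_pos m₂, Finset.sum_const, nsmul_eq_mul,
      hpair ha]
    ring
  rw [Finset.sum_congr rfl hinner, Finset.sum_const, nsmul_eq_mul, hpair (neg_ne_zero.2 ha)]
  ring

end Field

/-- Over `ZMod p`, the entries of a matrix in `𝔉_p` can be chosen one after the other. -/
theorem Frak_prime_iff {p : ℕ} [Fact p.Prime] (A : Matrix (Fin 2) (Fin 2) (ZMod p)) :
    Frak p A ↔ A 0 0 ∈ ({0} : Finset (ZMod p))ᶜ ∧ A 0 1 ∈ ({0, -A 0 0} : Finset (ZMod p))ᶜ ∧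
      A 1 0 ∈ ({0, A 0 0} : Finset (ZMod p))ᶜ ∧
      A 1 1 ∈ ({0, -A 1 0, A 0 1, A 0 0 + A 0 1 - A 1 0, A 0 1 * A 1 0 / A 0 0} :
        Finset (ZMod p))ᶜ := by
  simp only [Frak, isUnit_iff_ne_zero, Finset.mem_compl, Finset.mem_insert, Finset.mem_singleton,
    not_or]
  by_cases ha : A 0 0 = 0
  · simp [ha]
  · have hdet : A 1 1 = A 0 1 * A 1 0 / A 0 0 ↔ A 0 0 * A 1 1 - A 0 1 * A 1 0 = 0 := by
      rw [eq_div_iff ha, sub_eq_zero, mul_comm]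
    rw [hdet]
    grind

theorem card_Frak_prime (p : ℕ) [Fact p.Prime] :
    (Nat.card {A : Matrix (Fin 2) (Fin 2) (ZMod p) // Frak p A} : ℤ) =
      (p - 1) * (p - 2) * (p - 3) * (p - 4) := by
  let T : Finset (Σ _ : ZMod p, Σ _ : ZMod p, Σ _ : ZMod p, ZMod p) :=
    ({0}ᶜ : Finset (ZMod p)).sigma fun a => ({0, -a}ᶜ : Finset (ZMod p)).sigma fun b =>
      ({0, a}ᶜ : Finset (ZMod p)).sigma fun c => {0, -c, b, a + b - c, b * c / a}ᶜ
  let φ : Matrix (Fin 2) (Fin 2) (ZMod p) ≃ Σ _ : ZMod p, Σ _ : ZMod p, Σ _ : ZMod p, ZMod p :=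
    { toFun := fun A => ⟨A 0 0, A 0 1, A 1 0, A 1 1⟩
      invFun := fun t => !![t.1, t.2.1; t.2.2.1, t.2.2.2]
      left_inv := fun A => (Matrix.eta_fin_two A).symm
      right_inv := fun _ => rfl }
  have hφ (A) : Frak p A ↔ φ A ∈ T := by
    rw [Frak_prime_iff]
    simp only [T, Finset.mem_sigma]
    rfl
  rw [Nat.card_congr (φ.subtypeEquiv hφ), Nat.card_eq_fintype_card, Fintype.card_coe]
  simp only [T, Finset.card_sigma, Nat.cast_sum]
  rw [Finset.sum_congr rfl fun a ha => sum_card_corner (by simpa using ha), Finset.sum_const,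
    Finset.card_compl, Finset.card_singleton, ZMod.card, nsmul_eq_mul,
    Nat.cast_sub (Fact.out : p.Prime).one_le]
  push_cast
  ring

/-- For a prime `p` and `e ≥ 1`,
`|𝔉_{p^e}| = p^(4e-4) * (p-1)(p-2)(p-3)(p-4)`. -/
theorem card_Frak_prime_pow (p : ℕ) (hp : p.Prime) (e : ℕ) (he : 1 ≤ e) :
    Nat.card {A : Matrix (Fin 2) (Fin 2) (ZMod (p ^ e)) // Frak (p ^ e) A} =
      p ^ (4 * e - 4) * (p - 1) * (p - 2) * (p - 3) * (p - 4) := by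
  have : Fact p.Prime := ⟨hp⟩
  rw [card_Frak_pow (by omega), mul_assoc, mul_assoc, mul_assoc]
  congr 1
  have h := card_Frak_prime p
  have h2 := hp.two_le
  rcases (by omega : p = 2 ∨ p = 3 ∨ 4 ≤ p) with rfl | rfl | h4
  · simpa using h
  · simpa using h
  · zify [(by omega : 1 ≤ p), h2, (by omega : 3 ≤ p), h4]
    rw [h]
    ring
end

section
/- Let n ≥ 1 be a natural number. Then the cardinality of 𝔉_n satisfies |𝔉_n| · ∏_{p | n} p⁴ = n⁴ · ∏_{p | n} (p−1)(p−2)(p−3)(p−4), where both products range over the distinct primes p dividing n. Equivalently, |𝔉_n| = n⁴ · ∏_{p | n} (1 − 1/p)(1 − 2/p)(1 − 3/p)(1 − 4/p). -/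
open Matrix

/-- The condition defining `Frak`, over an arbitrary commutative ring. -/
def FrakOver (R : Type*) [CommRing R] (A : Matrix (Fin 2) (Fin 2) R) : Prop :=
  IsUnit (A 0 0 * A 1 1 - A 0 1 * A 1 0) ∧
  IsUnit (A 0 0) ∧ IsUnit (A 0 1) ∧ IsUnit (A 1 0) ∧ IsUnit (A 1 1) ∧
  IsUnit (A 0 0 + A 0 1) ∧ IsUnit (A 1 0 + A 1 1) ∧
  IsUnit (A 0 0 - A 1 0) ∧ IsUnit (A 0 1 - A 1 1) ∧
  IsUnit (A 0 0 + A 0 1 - A 1 0 - A 1 1)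

theorem frakOver_map_iff {R S : Type*} [CommRing R] [CommRing S] (f : R →+* S) [IsLocalHom f]
    (A : Matrix (Fin 2) (Fin 2) R) : FrakOver S (A.map f) ↔ FrakOver R A := by
  simp only [FrakOver, Matrix.map_apply, ← map_mul, ← map_add, ← map_sub, isUnit_map_iff]

theorem frakOver_prod_iff {S T : Type*} [CommRing S] [CommRing T]
    (A : Matrix (Fin 2) (Fin 2) (S × T)) :
    FrakOver (S × T) A ↔ FrakOver S (A.map Prod.fst) ∧ FrakOver T (A.map Prod.snd) := by
  simp only [FrakOver, Matrix.map_apply, Prod.isUnit_iff, Prod.fst_sub, Prod.snd_sub,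
    Prod.fst_add, Prod.snd_add, Prod.fst_mul, Prod.snd_mul]
  tauto

theorem card_frakOver_congr {R S : Type*} [CommRing R] [CommRing S] (e : R ≃+* S) :
    Nat.card {A // FrakOver R A} = Nat.card {A // FrakOver S A} :=
  Nat.card_congr <| e.mapMatrix.toEquiv.subtypeEquiv fun A =>
    (frakOver_map_iff (e : R →+* S) A).symm

theorem card_frakOver_prod (S T : Type*) [CommRing S] [CommRing T] :
    Nat.card {A // FrakOver (S × T) A} =
      Nat.card {A // FrakOver S A} * Nat.card {A // FrakOver T A} := by
  let e : Matrix (Fin 2) (Fin 2) (S × T) ≃ Matrix (Fin 2) (Fin 2) S × Matrix (Fin 2) (Fin 2) T :=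
    { toFun := fun A => (A.map Prod.fst, A.map Prod.snd)
      invFun := fun B => Matrix.of fun i j => (B.1 i j, B.2 i j)
      left_inv := fun _ => rfl
      right_inv := fun _ => rfl }
  rw [← Nat.card_prod]
  exact Nat.card_congr ((e.subtypeEquiv fun A => frakOver_prod_iff A).trans
    Equiv.subtypeProdEquivProd)

theorem AddMonoidHom.card_subtype_comp_mul {M N : Type*} [AddGroup M] [AddGroup N] (g : M →+ N)
    (hg : Function.Surjective g) (P : N → Prop) :
    Nat.card {A // P (g A)} * Nat.card N = Nat.card M * Nat.card {B // P B} := by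
  obtain ⟨s, hs⟩ := hg.hasRightInverse
  let e : M ≃ g.ker × N :=
    { toFun := fun x => (⟨x - s (g x), by simp [AddMonoidHom.mem_ker, hs (g x)]⟩, g x)
      invFun := fun y => y.1 + s y.2
      left_inv := fun x => by simp
      right_inv := fun y => by
        have h : g y.1 = 0 := y.1.2
        ext <;> simp [h, hs y.2] }
  have h₁ : Nat.card {A // P (g A)} = Nat.card g.ker * Nat.card {B // P B} := by
    rw [← Nat.card_prod]
    refine Nat.card_congr ((e.subtypeEquiv (q := fun y => True ∧ P y.2) fun A => ?_).trans
      (Equiv.subtypeProdEquivProd.trans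
        ((Equiv.subtypeUnivEquiv fun _ => trivial).prodCongr (Equiv.refl _))))
    simp [e]
  rw [h₁, Nat.card_congr e, Nat.card_prod]
  ring

theorem card_matrix_fin_two (X : Type*) :
    Nat.card (Matrix (Fin 2) (Fin 2) X) = Nat.card X ^ 4 := by
  simp only [Matrix, Nat.card_fun, Nat.card_fin, ← pow_mul]

theorem card_frakOver_mul_of_surjective {R S : Type*} [CommRing R] [CommRing S] (f : R →+* S)
    [IsLocalHom f] (hf : Function.Surjective f) :
    Nat.card {A // FrakOver R A} * Nat.card S ^ 4 =
      Nat.card R ^ 4 * Nat.card {A // FrakOver S A} := by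
  have h := f.mapMatrix.toAddMonoidHom.card_subtype_comp_mul (M := Matrix (Fin 2) (Fin 2) R)
    (fun B => ⟨B.map (Function.surjInv hf), by ext; simp [Function.surjInv_eq hf]⟩) (FrakOver S)
  rw [card_matrix_fin_two, card_matrix_fin_two] at h
  rw [← h]
  congr 1
  exact Nat.card_congr (Equiv.subtypeEquivRight fun A => (frakOver_map_iff f A).symm)

theorem card_excluded {F : Type*} [Field F] [DecidableEq F] {b c : F}
    (hb : b ≠ 0) (hb' : b ≠ -1) (hc : c ≠ 0) (hc' : c ≠ 1) :
    ((({0, -c, b, 1 + b - c, b * c} : Finset F).card : ℕ) : ℤ) =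
      5 - (if c = 1 + b then 1 else 0) - (if c = -b then 1 else 0) := by
  have h₁ : (0 : F) ≠ -c := by grind
  have h₂ : (0 : F) ≠ b * c := by grind
  have h₃ : -c ≠ 1 + b - c := by grind
  have h₄ : -c ≠ b * c := by grind
  have h₅ : b ≠ 1 + b - c := by grind
  have h₆ : b ≠ b * c := by grind
  have h₇ : 1 + b - c ≠ b * c := by
    intro h
    have : (1 + b) * (1 - c) = 0 := by linear_combination h
    grind
  have h₈ : 0 = 1 + b - c ↔ c = 1 + b := by grind
  have h₉ : -c = b ↔ c = -b := by grind
  simp only [Finset.card_insert_eq_ite, Finset.mem_insert, Finset.mem_singleton,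
    Finset.card_singleton, h₁, h₂, h₃, h₄, h₅, h₆, h₇, h₈, h₉, hb.symm, or_false, false_or,
    if_false]
  split_ifs <;> norm_num

/-- The triples `(b, c, d)` such that `[[1, b], [c, d]]` satisfies `FrakOver F`. -/
def normalizedTriples (F : Type*) [Field F] [Fintype F] [DecidableEq F] :
    Finset (Σ _ : F × F, F) :=
  (({0, -1}ᶜ : Finset F) ×ˢ ({0, 1}ᶜ : Finset F)).sigma
    fun x => {0, -x.2, x.1, 1 + x.1 - x.2, x.1 * x.2}ᶜ

theorem card_normalizedTriples {F : Type*} [Field F] [Fintype F] [DecidableEq F] :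
    ((normalizedTriples F).card : ℤ) =
      (Fintype.card F - 2) * (Fintype.card F - 3) * (Fintype.card F - 4) := by
  have card_compl (s : Finset F) : ((sᶜ.card : ℕ) : ℤ) = Fintype.card F - s.card := by
    rw [Finset.card_compl, Nat.cast_sub s.card_le_univ]
  have hB : ((({0, -1}ᶜ : Finset F).card : ℕ) : ℤ) = Fintype.card F - 2 := by
    rw [card_compl, Finset.card_pair (by simp)]; rfl
  have hC : ((({0, 1}ᶜ : Finset F).card : ℕ) : ℤ) = Fintype.card F - 2 := by
    rw [card_compl, Finset.card_pair (by simp)]; rfl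
  have key : ∀ b ∈ ({0, -1}ᶜ : Finset F), ∑ c ∈ ({0, 1}ᶜ : Finset F),
      ((({0, -c, b, 1 + b - c, b * c}ᶜ : Finset F).card : ℕ) : ℤ) =
        (Fintype.card F - 2) * (Fintype.card F - 5) + 2 := by
    intro b hb
    simp only [Finset.mem_compl, Finset.mem_insert, Finset.mem_singleton, not_or] at hb
    have h₁ : 1 + b ∈ ({0, 1}ᶜ : Finset F) := by simp; grind
    have h₂ : -b ∈ ({0, 1}ᶜ : Finset F) := by simp; grind
    calc _ = ∑ c ∈ ({0, 1}ᶜ : Finset F), (((Fintype.card F : ℤ) - 5)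
          + (if c = 1 + b then 1 else 0) + (if c = -b then 1 else 0)) := by
          refine Finset.sum_congr rfl fun c hc => ?_
          simp only [Finset.mem_compl, Finset.mem_insert, Finset.mem_singleton, not_or] at hc
          rw [card_compl, card_excluded hb.1 hb.2 hc.1 hc.2]
          ring
      _ = _ := by
          rw [Finset.sum_add_distrib, Finset.sum_add_distrib, Finset.sum_ite_eq',
            Finset.sum_ite_eq', if_pos h₁, if_pos h₂, Finset.sum_const, nsmul_eq_mul, hC]
          ring
  rw [normalizedTriples, Finset.card_sigma, Nat.cast_sum, Finset.sum_product,
    Finset.sum_congr rfl key, Finset.sum_const, nsmul_eq_mul, hB]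
  ring

theorem mem_normalizedTriples_iff {F : Type*} [Field F] [Fintype F] [DecidableEq F]
    (b c d : F) :
    (⟨(b, c), d⟩ : Σ _ : F × F, F) ∈ normalizedTriples F ↔ FrakOver F !![1, b; c, d] := by
  simp only [normalizedTriples, FrakOver, Finset.mem_sigma, Finset.mem_product, Finset.mem_compl,
    Finset.mem_insert, Finset.mem_singleton, isUnit_iff_ne_zero, Matrix.of_apply, Matrix.cons_val',
    Matrix.cons_val_zero, Matrix.cons_val_one, Matrix.cons_val_fin_one]
  have h₁ : 1 + b = 0 ↔ b = -1 := by grind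
  have h₂ : 1 - c = 0 ↔ c = 1 := by grind
  have h₃ : c + d = 0 ↔ d = -c := by grind
  have h₄ : b - d = 0 ↔ d = b := by grind
  have h₅ : 1 + b - c - d = 0 ↔ d = 1 + b - c := by grind
  have h₆ : 1 * d - b * c = 0 ↔ d = b * c := by grind
  simp only [ne_eq, h₁, h₂, h₃, h₄, h₅, h₆, one_ne_zero, not_false_eq_true, true_and, not_or]
  tauto

theorem frakOver_smul_iff {F : Type*} [Field F] {a : F} (ha : a ≠ 0)
    (A : Matrix (Fin 2) (Fin 2) F) :
    FrakOver F (a • A) ↔ FrakOver F A := by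
  have h : a * A 0 0 * (a * A 1 1) - a * A 0 1 * (a * A 1 0) =
      a * (a * (A 0 0 * A 1 1 - A 0 1 * A 1 0)) := by ring
  simp only [FrakOver, Matrix.smul_apply, smul_eq_mul, isUnit_iff_ne_zero, h, ← mul_add, ← mul_sub,
    mul_ne_zero_iff, ne_eq, ha, not_false_eq_true, true_and]

theorem card_frakOver_eq_mul {F : Type*} [Field F] [Fintype F] [DecidableEq F] :
    Nat.card {A // FrakOver F A} = Nat.card Fˣ * (normalizedTriples F).card := by
  rw [← Nat.card_eq_finsetCard, ← Nat.card_prod]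
  symm
  have aux (x : normalizedTriples F) : FrakOver F !![1, x.1.1.1; x.1.1.2, x.1.2] :=
    (mem_normalizedTriples_iff _ _ _).1 x.2
  refine Nat.card_eq_of_bijective (fun x : Fˣ × normalizedTriples F =>
    (⟨(x.1 : F) • !![1, x.2.1.1.1; x.2.1.1.2, x.2.1.2],
      (frakOver_smul_iff x.1.ne_zero _).2 (aux x.2)⟩ : {A // FrakOver F A})) ⟨?_, ?_⟩
  · rintro ⟨a, ⟨⟨⟨b, c⟩, d⟩, h⟩⟩ ⟨a', ⟨⟨⟨b', c'⟩, d'⟩, h'⟩⟩ heq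
    have hA := Subtype.ext_iff.1 heq
    have e (i j : Fin 2) := congrFun (congrFun hA i) j
    have ha : a = a' := Units.ext (by simpa using e 0 0)
    subst ha
    have hb : b = b' := by simpa using e 0 1
    have hc : c = c' := by simpa using e 1 0
    have hd : d = d' := by simpa using e 1 1
    subst hb hc hd
    rfl
  · rintro ⟨A, hA⟩
    have ha : A 0 0 ≠ 0 := hA.2.1.ne_zero
    have hsmul : A = A 0 0 • !![1, A 0 1 / A 0 0; A 1 0 / A 0 0, A 1 1 / A 0 0] := by
      ext i j
      fin_cases i <;> fin_cases j <;> simp [mul_div_cancel₀, ha]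
    refine ⟨(Units.mk0 _ ha, ⟨⟨(A 0 1 / A 0 0, A 1 0 / A 0 0), A 1 1 / A 0 0⟩, ?_⟩),
      Subtype.ext hsmul.symm⟩
    rw [mem_normalizedTriples_iff, ← frakOver_smul_iff ha, ← hsmul]
    exact hA

theorem card_frakOver_field {F : Type*} [Field F] [Fintype F] :
    Nat.card {A // FrakOver F A} =
      (Fintype.card F - 1) * (Fintype.card F - 2) * (Fintype.card F - 3) *
        (Fintype.card F - 4) := by
  classical
  have h := card_normalizedTriples (F := F)
  rw [card_frakOver_eq_mul, Nat.card_eq_fintype_card, Fintype.card_units, mul_assoc, mul_assoc,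
    ← mul_assoc (Fintype.card F - 2)]
  congr 1
  have hq : 2 ≤ Fintype.card F := Fintype.one_lt_card
  generalize Fintype.card F = q at *
  obtain rfl | rfl | hq : q = 2 ∨ q = 3 ∨ 4 ≤ q := by omega
  · simpa using h
  · simpa using h
  · zify [hq, (by omega : 3 ≤ q), (by omega : 2 ≤ q)]
    exact h

theorem ZMod.isLocalHom_castHom_prime_pow {p k : ℕ} (hp : p.Prime) (hk : 0 < k) :
    IsLocalHom (ZMod.castHom (dvd_pow_self p hk.ne') (ZMod p)) := by
  have : NeZero (p ^ k) := ⟨pow_ne_zero _ hp.ne_zero⟩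
  refine ⟨fun x hx => ?_⟩
  rw [← ZMod.natCast_zmod_val x] at hx ⊢
  rw [map_natCast, ZMod.isUnit_iff_coprime] at hx
  exact (ZMod.isUnit_iff_coprime _ _).2 (hx.pow_right k)

theorem card_frakOver_zmod_prime_pow {p k : ℕ} (hp : p.Prime) (hk : 0 < k) :
    Nat.card {A // FrakOver (ZMod (p ^ k)) A} * p ^ 4 =
      (p ^ k) ^ 4 * ((p - 1) * (p - 2) * (p - 3) * (p - 4)) := by
  have : Fact p.Prime := ⟨hp⟩
  have := ZMod.isLocalHom_castHom_prime_pow hp hk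
  have h := card_frakOver_mul_of_surjective (ZMod.castHom (dvd_pow_self p hk.ne') (ZMod p))
    (ZMod.castHom_surjective _)
  rwa [card_frakOver_field, Nat.card_zmod, Nat.card_zmod, ZMod.card] at h

/-- `|𝔉ₙ| * ∏_{p ∣ n} p⁴ = n⁴ * ∏_{p ∣ n} (p-1)(p-2)(p-3)(p-4)`,
the products ranging over distinct primes dividing `n`. -/
theorem card_Frak_formula (n : ℕ) (hn : 1 ≤ n) :
    Nat.card {A : Matrix (Fin 2) (Fin 2) (ZMod n) // Frak n A} *
        ∏ p ∈ n.primeFactors, p ^ 4 =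
      n ^ 4 * ∏ p ∈ n.primeFactors, (p - 1) * (p - 2) * (p - 3) * (p - 4) := by
  change Nat.card {A // FrakOver (ZMod n) A} * _ = _
  induction n using Nat.recOnPosPrimePosCoprime with
  | zero => omega
  | one =>
    have : Unique {A // FrakOver (ZMod 1) A} :=
      { default := ⟨0, by simp only [FrakOver, isUnit_of_subsingleton, and_self]⟩
        uniq := fun _ => Subsingleton.elim _ _ }
    simp
  | prime_pow p k hp hk =>
    rw [Nat.primeFactors_prime_pow hk.ne' hp, Finset.prod_singleton, Finset.prod_singleton]
    exact card_frakOver_zmod_prime_pow hp hk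
  | coprime a b ha hb hab iha ihb =>
    rw [card_frakOver_congr (ZMod.chineseRemainder hab), card_frakOver_prod,
      hab.primeFactors_mul, Finset.prod_union hab.disjoint_primeFactors,
      Finset.prod_union hab.disjoint_primeFactors, mul_mul_mul_comm, iha ha.le, ihb hb.le]
    ring
end

section
/- Let p ≥ 5 be a prime and e ≥ 1. Then the number of matrices A = [[a,b],[c,d]] in 𝔉_{p^e} satisfying c = −b and d = a + b equals p^{2e−2}·(p−1)(p−2) if p ≡ 2 (mod 3), and equals p^{2e−2}·(p−1)(p−4) if p ≡ 1 (mod 3). -/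
open Matrix

/-- An additive group homomorphism onto a finite group of cardinality `m` has fibres of
cardinality `|G| / m`, so preimages of sets scale accordingly. -/
theorem card_preimage_mul_card_of_surjective {G H : Type*} [AddGroup G] [Fintype G] [AddGroup H]
    [Fintype H] [DecidableEq H] (f : G →+ H) (hf : Function.Surjective f) (S : Finset H) :
    (Finset.univ.filter fun g => f g ∈ S).card * Fintype.card H = S.card * Fintype.card G := by
  have fiber (y : H) : (Finset.univ.filter fun g => f g = y).card =
      (Finset.univ.filter fun g => f g = 0).card :=
    AddMonoidHom.card_fiber_eq_of_mem_range f (hf y) (hf 0)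
  have count (T : Finset H) : (Finset.univ.filter fun g => f g ∈ T).card =
      T.card * (Finset.univ.filter fun g => f g = 0).card := by
    rw [Finset.card_eq_sum_card_fiberwise (f := f) (t := T) (by intro x hx; simpa using hx),
      Finset.sum_const_nat]
    intro y hy
    rw [← fiber y, Finset.filter_filter]
    congr 1
    ext g
    simp only [Finset.mem_filter, Finset.mem_univ, true_and]
    exact ⟨fun h => h.2, fun h => ⟨h ▸ hy, h⟩⟩
  have total := count Finset.univ
  simp only [Finset.mem_univ, Finset.filter_true, Finset.card_univ] at total
  rw [count, total]
  ring

theorem isUnit_zmod_prime_pow_iff {p e : ℕ} [Fact p.Prime] (he : e ≠ 0) (x : ZMod (p ^ e)) :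
    IsUnit x ↔ ZMod.castHom (dvd_pow_self p he) (ZMod p) x ≠ 0 := by
  have hp : p.Prime := Fact.out
  have : NeZero (p ^ e) := ⟨pow_ne_zero _ hp.ne_zero⟩
  obtain ⟨n, rfl⟩ := ZMod.natCast_zmod_surjective x
  rw [ZMod.isUnit_iff_coprime, map_natCast, Ne, ZMod.natCast_eq_zero_iff,
    Nat.coprime_pow_right_iff (Nat.pos_of_ne_zero he), Nat.coprime_comm,
    hp.coprime_iff_not_dvd]

/-- The elements `t` of a field for which `t`, `1 + t` and `1 + t + t²` are all nonzero. -/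
def admissibleRatios (F : Type*) [Field F] [Fintype F] [DecidableEq F] : Finset F :=
  Finset.univ.filter fun t => t ≠ 0 ∧ 1 + t ≠ 0 ∧ 1 + t + t ^ 2 ≠ 0

theorem orderOf_eq_three_of_one_add_add_sq {F : Type*} [Field F] (h3 : (3 : F) ≠ 0) {t : F}
    (ht : 1 + t + t ^ 2 = 0) : orderOf t = 3 := by
  have : Fact (Nat.Prime 3) := ⟨Nat.prime_three⟩
  refine orderOf_eq_prime (by linear_combination (t - 1) * ht) ?_
  rintro rfl
  exact h3 (by linear_combination ht)

theorem card_admissibleRatios_of_mod_three_eq_two {p : ℕ} [Fact p.Prime] (hp5 : 5 ≤ p)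
    (hmod : p % 3 = 2) : (admissibleRatios (ZMod p)).card = p - 2 := by
  have h3 : (3 : ZMod p) ≠ 0 := by
    intro h
    have := Nat.le_of_dvd (by norm_num) ((ZMod.natCast_eq_zero_iff 3 p).1 (by exact_mod_cast h))
    omega
  have no_root (t : ZMod p) : 1 + t + t ^ 2 ≠ 0 := by
    intro ht
    have ht0 : t ≠ 0 := by rintro rfl; simp at ht
    have := orderOf_dvd_of_pow_eq_one (ZMod.pow_card_sub_one_eq_one ht0)
    rw [orderOf_eq_three_of_one_add_add_sq h3 ht] at this
    omega
  have : admissibleRatios (ZMod p) = Finset.univ \ {0, -1} := by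
    ext t
    have shift : 1 + t = 0 ↔ t = -1 := by rw [add_comm, eq_neg_iff_add_eq_zero]
    simp [admissibleRatios, no_root, shift]
  rw [this, Finset.card_sdiff_of_subset (Finset.subset_univ _), Finset.card_univ, ZMod.card,
    Finset.card_pair (by simp)]

theorem card_admissibleRatios_of_mod_three_eq_one {p : ℕ} [Fact p.Prime] (hp5 : 5 ≤ p)
    (hmod : p % 3 = 1) : (admissibleRatios (ZMod p)).card = p - 4 := by
  have h3 : (3 : ZMod p) ≠ 0 := by
    intro h
    have := Nat.le_of_dvd (by norm_num) ((ZMod.natCast_eq_zero_iff 3 p).1 (by exact_mod_cast h))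
    omega
  have : Fact (Nat.Prime 3) := ⟨Nat.prime_three⟩
  obtain ⟨u, hu⟩ := exists_prime_orderOf_dvd_card (G := (ZMod p)ˣ) 3 (by
    rw [ZMod.card_units]; omega)
  rw [← orderOf_units] at hu
  generalize (u : ZMod p) = w at hu
  have hw3 : w ^ 3 = 1 := hu ▸ pow_orderOf_eq_one w
  have hw1 : w - 1 ≠ 0 := by
    intro h
    rw [sub_eq_zero.1 h, orderOf_one] at hu
    omega
  have hw : 1 + w + w ^ 2 = 0 :=
    (mul_eq_zero.1 (show (w - 1) * (1 + w + w ^ 2) = 0 by linear_combination hw3)).resolve_left hw1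
  have : admissibleRatios (ZMod p) = Finset.univ \ {0, -1, w, -1 - w} := by
    ext t
    have roots : 1 + t + t ^ 2 = 0 ↔ t = w ∨ t = -1 - w := by
      rw [show 1 + t + t ^ 2 = (t - w) * (t - (-1 - w)) by linear_combination hw,
        mul_eq_zero, sub_eq_zero, sub_eq_zero]
    have shift : 1 + t = 0 ↔ t = -1 := by rw [add_comm, eq_neg_iff_add_eq_zero]
    simp [admissibleRatios, roots, shift]
  have hcard : ({0, -1, w, -1 - w} : Finset (ZMod p)).card = 4 := by
    have hw0 : w ≠ 0 := by rintro rfl; simp at hw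
    have hwneg : -1 - w ≠ 0 := fun h => hw0 (pow_eq_zero_iff two_ne_zero |>.1
      (by linear_combination hw + h))
    have hwadd : w ≠ -1 := by rintro rfl; simp at hwneg
    have hne : w ≠ -1 - w := by
      intro h
      exact h3 (by linear_combination 4 * hw - (2 * w + 1) * h)
    rw [Finset.card_insert_of_notMem, Finset.card_insert_of_notMem, Finset.card_pair hne]
    · have hneg : (-1 : ZMod p) ≠ -1 - w := fun h => hw0 (by linear_combination h)
      simp [hwadd.symm, hneg]
    · simp [hw0.symm, hwneg.symm]
  rw [this, Finset.card_sdiff_of_subset (Finset.subset_univ _), Finset.card_univ, ZMod.card, hcard]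

theorem frak_fixed_iff {n : ℕ} (A : Matrix (Fin 2) (Fin 2) (ZMod n)) (u : (ZMod n)ˣ) (t : ZMod n)
    (hA : A = !![(u : ZMod n), u * t; -(u * t), u + u * t]) :
    Frak n A ↔ IsUnit t ∧ IsUnit (1 + t) ∧ IsUnit (1 + t + t ^ 2) := by
  have hadd : (u : ZMod n) + u * t = u * (1 + t) := by ring
  have hdet : (u : ZMod n) * (u + u * t) - u * t * -(u * t) = u * (u * (1 + t + t ^ 2)) := by ring
  have hrow : -((u : ZMod n) * t) + u * (1 + t) = u := by ring
  have hcol : (u : ZMod n) * t - u * (1 + t) = -u := by ring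
  have hall : (u : ZMod n) * (1 + t) + u * t - u * (1 + t) = u * t := by ring
  subst hA
  simp only [Frak, of_apply, cons_val', cons_val_zero, cons_val_one, cons_val_fin_one, hdet]
  simp only [hadd, hrow, hcol, hall, sub_neg_eq_add, IsUnit.neg_iff, Units.isUnit_units_mul,
    Units.isUnit]
  tauto

/-- A matrix `[[a, b], [-b, a + b]]` in `𝔉ₙ` is determined by the unit `a` and the ratio `b / a`. -/
theorem card_fixed_eq_card_units_mul_card_ratios (n : ℕ) :
    Nat.card {A : Matrix (Fin 2) (Fin 2) (ZMod n) //
        Frak n A ∧ A 1 0 = -A 0 1 ∧ A 1 1 = A 0 0 + A 0 1} =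
      Nat.card (ZMod n)ˣ *
        Nat.card {t : ZMod n // IsUnit t ∧ IsUnit (1 + t) ∧ IsUnit (1 + t + t ^ 2)} := by
  rw [← Nat.card_prod]
  symm
  refine Nat.card_eq_of_bijective (fun x => ⟨!![(x.1 : ZMod n), x.1 * x.2.1;
    -(x.1 * x.2.1), x.1 + x.1 * x.2.1],
    (frak_fixed_iff _ x.1 x.2.1 rfl).2 x.2.2, by simp, by simp⟩) ⟨?_, ?_⟩
  · rintro ⟨u, t, ht⟩ ⟨v, s, hs⟩ h
    have hM := congrArg Subtype.val h
    have huv : u = v := Units.ext (by simpa using congrFun (congrFun hM 0) 0)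
    subst huv
    have hts : t = s := by simpa using congrFun (congrFun hM 0) 1
    subst hts
    rfl
  · rintro ⟨A, hF, h10, h11⟩
    obtain ⟨u, hu⟩ := hF.2.1
    have hA : A = !![(u : ZMod n), u * (↑u⁻¹ * A 0 1); -(u * (↑u⁻¹ * A 0 1)),
        u + u * (↑u⁻¹ * A 0 1)] := by
      rw [Units.mul_inv_cancel_left]
      ext i j
      fin_cases i <;> fin_cases j <;> simp [hu, h10, h11]
    exact ⟨(u, ⟨_, (frak_fixed_iff A u _ hA).1 hF⟩), Subtype.ext hA.symm⟩

theorem card_ratios_zmod_prime_pow {p e : ℕ} [Fact p.Prime] (he : e ≠ 0) :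
    Nat.card {t : ZMod (p ^ e) // IsUnit t ∧ IsUnit (1 + t) ∧ IsUnit (1 + t + t ^ 2)} =
      (admissibleRatios (ZMod p)).card * p ^ (e - 1) := by
  have hp : p.Prime := Fact.out
  have : NeZero (p ^ e) := ⟨pow_ne_zero _ hp.ne_zero⟩
  have h := card_preimage_mul_card_of_surjective
    (ZMod.castHom (dvd_pow_self p he) (ZMod p)).toAddMonoidHom
    (ZMod.castHom_surjective (dvd_pow_self p he)) (admissibleRatios (ZMod p))
  have hpow : (admissibleRatios (ZMod p)).card * p ^ e =
      (admissibleRatios (ZMod p)).card * p ^ (e - 1) * p := by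
    rw [mul_assoc, pow_sub_one_mul he]
  rw [ZMod.card, ZMod.card, hpow] at h
  rw [← Nat.eq_of_mul_eq_mul_right hp.pos h, ← Fintype.card_subtype, ← Nat.card_eq_fintype_card]
  refine Nat.card_congr (Equiv.subtypeEquivRight fun t => ?_)
  simp only [isUnit_zmod_prime_pow_iff he, map_add, map_one, map_pow, admissibleRatios,
    Finset.mem_filter, Finset.mem_univ, true_and]
  rfl

/-- The number of matrices `[[a,b],[-b,a+b]]` in `𝔉_{p^e}` (the fixed points
of the order-3 element `(σ₃,σ₃)`): it is `p^(2e-2)(p-1)(p-2)` if `p ≡ 2 (mod 3)` and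
`p^(2e-2)(p-1)(p-4)` if `p ≡ 1 (mod 3)`. -/
theorem card_fixed_sigma3 (p : ℕ) (hp : p.Prime) (hp5 : 5 ≤ p) (e : ℕ) (he : 1 ≤ e) :
    (p % 3 = 2 →
      Nat.card {A : Matrix (Fin 2) (Fin 2) (ZMod (p ^ e)) //
          Frak (p ^ e) A ∧ A 1 0 = -A 0 1 ∧ A 1 1 = A 0 0 + A 0 1} =
        p ^ (2 * e - 2) * (p - 1) * (p - 2)) ∧
    (p % 3 = 1 →
      Nat.card {A : Matrix (Fin 2) (Fin 2) (ZMod (p ^ e)) //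
          Frak (p ^ e) A ∧ A 1 0 = -A 0 1 ∧ A 1 1 = A 0 0 + A 0 1} =
        p ^ (2 * e - 2) * (p - 1) * (p - 4)) := by
  have : Fact p.Prime := ⟨hp⟩
  have he0 : e ≠ 0 := by omega
  have hpow : p ^ (2 * e - 2) = p ^ (e - 1) * p ^ (e - 1) := by
    rw [← pow_add]
    congr 1
    omega
  rw [card_fixed_eq_card_units_mul_card_ratios, card_ratios_zmod_prime_pow he0,
    Nat.card_eq_fintype_card, ZMod.card_units_eq_totient, Nat.totient_prime_pow hp (by omega), hpow]
  constructor <;> intro hmod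
  · rw [card_admissibleRatios_of_mod_three_eq_two hp5 hmod]
    ring
  · rw [card_admissibleRatios_of_mod_three_eq_one hp5 hmod]
    ring
end

section
/- Let p ≥ 5 be a prime and e ≥ 1. Then the number of matrices A in 𝔉_{p^e} satisfying A·A = I (equivalently A = A⁻¹) equals p^{2e−2}·(p−3)(p−5). -/
open Matrix

/-- Conditions on the first entry `a` of an involution in `𝔉ₙ` and the sum `s` of its first row. -/
def RowData (R : Type*) [CommRing R] (x : R × R) : Prop :=
  IsUnit x.1 ∧ IsUnit x.2 ∧ IsUnit (x.2 - x.1) ∧ IsUnit (1 - x.1 ^ 2) ∧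
    IsUnit (x.1 * x.2 - 1) ∧ IsUnit (x.2 ^ 2 - 1)

theorem involution_entries {R : Type*} [CommRing R] {A : Matrix (Fin 2) (Fin 2) R}
    (hb : IsUnit (A 0 1)) (hA : A * A = 1) :
    A 1 1 = -A 0 0 ∧ A 0 1 * A 1 0 = 1 - A 0 0 ^ 2 := by
  have h00 := congrFun (congrFun hA 0) 0
  have h01 := congrFun (congrFun hA 0) 1
  simp only [Matrix.mul_apply, Fin.sum_univ_two, Matrix.one_apply_eq] at h00 h01
  rw [Matrix.one_apply_ne (by decide)] at h01
  refine ⟨hb.mul_left_cancel ?_, ?_⟩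
  · linear_combination h01
  · linear_combination h00

theorem frak_iff_rowData {n : ℕ} {A : Matrix (Fin 2) (Fin 2) (ZMod n)}
    (hb : IsUnit (A 0 1)) (hd : A 1 1 = -A 0 0) (hc : A 0 1 * A 1 0 = 1 - A 0 0 ^ 2) :
    Frak n A ↔ RowData (ZMod n) (A 0 0, A 0 0 + A 0 1) := by
  have key (x : ZMod n) : IsUnit x ↔ IsUnit (A 0 1 * x) := by
    rw [IsUnit.mul_iff]; simp [hb]
  have h1 : IsUnit (A 0 0 * A 1 1 - A 0 1 * A 1 0) := by
    have : A 0 0 * A 1 1 - A 0 1 * A 1 0 = -1 := by rw [hd, hc]; ring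
    rw [this]; exact isUnit_one.neg
  have h2 : IsUnit (A 1 0) ↔ IsUnit (1 - A 0 0 ^ 2) := by rw [key, hc]
  have h3 : IsUnit (A 0 0 - A 1 0) ↔ IsUnit (A 0 0 * (A 0 0 + A 0 1) - 1) := by
    rw [key, show A 0 1 * (A 0 0 - A 1 0) = A 0 0 * (A 0 0 + A 0 1) - 1 by
      linear_combination -hc]
  have h4 : IsUnit (A 1 0 + A 1 1) ↔ IsUnit (A 0 0 - A 1 0) := by
    rw [← IsUnit.neg_iff, hd]; ring_nf
  have h5 : IsUnit (A 0 1 - A 1 1) ↔ IsUnit (A 0 0 + A 0 1) := by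
    rw [hd]; ring_nf
  have h6 : IsUnit (A 0 0 + A 0 1 - A 1 0 - A 1 1) ↔ IsUnit ((A 0 0 + A 0 1) ^ 2 - 1) := by
    rw [key, show A 0 1 * (A 0 0 + A 0 1 - A 1 0 - A 1 1) = (A 0 0 + A 0 1) ^ 2 - 1 by
      rw [hd]; linear_combination -hc]
  have h7 : IsUnit (A 1 1) ↔ IsUnit (A 0 0) := by rw [hd, IsUnit.neg_iff]
  simp only [Frak, RowData, h2, h4, h3, h5, h6, h7, add_sub_cancel_left]
  tauto

theorem card_involutions_eq_card_rowData (n : ℕ) :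
    Nat.card {A : Matrix (Fin 2) (Fin 2) (ZMod n) // Frak n A ∧ A * A = 1} =
      Nat.card {x : ZMod n × ZMod n // RowData (ZMod n) x} := by
  refine Nat.card_eq_of_bijective (fun A => ⟨(A.1 0 0, A.1 0 0 + A.1 0 1), ?_⟩) ⟨?_, ?_⟩
  · obtain ⟨A, hF, hA⟩ := A
    have hb := hF.2.2.1
    obtain ⟨hd, hc⟩ := involution_entries hb hA
    exact (frak_iff_rowData hb hd hc).1 hF
  · rintro ⟨A, hF, hA⟩ ⟨B, hG, hB⟩ h
    obtain ⟨hd, hc⟩ := involution_entries hF.2.2.1 hA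
    obtain ⟨hd', hc'⟩ := involution_entries hG.2.2.1 hB
    simp only [Subtype.mk.injEq, Prod.mk.injEq] at h
    obtain ⟨ha, hs⟩ := h
    have hb : A 0 1 = B 0 1 := by linear_combination hs - ha
    have hcc : A 1 0 = B 1 0 := by
      refine hF.2.2.1.mul_left_cancel ?_
      rw [hc, hb, hc', ha]
    refine Subtype.ext ?_
    ext i j
    fin_cases i <;> fin_cases j
    · exact ha
    · exact hb
    · exact hcc
    · exact hd.trans ((congrArg Neg.neg ha).trans hd'.symm)
  · rintro ⟨⟨a, s⟩, h⟩
    obtain ⟨u, hu⟩ : IsUnit (s - a) := h.2.2.1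
    have hb : IsUnit ((!![a, s - a; (↑u⁻¹ : ZMod n) * (1 - a ^ 2), -a] :
        Matrix (Fin 2) (Fin 2) (ZMod n)) 0 1) := h.2.2.1
    have hinv : (s - a) * ((↑u⁻¹ : ZMod n) * (1 - a ^ 2)) = 1 - a ^ 2 := by
      rw [← hu, Units.mul_inv_cancel_left]
    refine ⟨⟨!![a, s - a; (↑u⁻¹ : ZMod n) * (1 - a ^ 2), -a], ?_, ?_⟩, ?_⟩
    · refine (frak_iff_rowData hb rfl hinv).2 ?_
      simpa using h
    · ext i j
      fin_cases i <;> fin_cases j <;> simp [Matrix.mul_apply, Fin.sum_univ_two]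
      · linear_combination hinv
      · ring
      · ring
      · linear_combination hinv
    · simp

/-- A predicate pulled back along a surjective homomorphism of finite groups scales its count by
the ratio of the orders. -/
theorem card_subtype_comp_mul_card {G H : Type*} [AddGroup G] [AddGroup H] [Finite G] [Finite H]
    (f : G →+ H) (hf : Function.Surjective f) (P : H → Prop) :
    Nat.card {x // P (f x)} * Nat.card H = Nat.card G * Nat.card {y // P y} := by
  have fib (Q : H → Prop) :
      Nat.card {x // Q (f x)} = Nat.card {y // Q y} * Nat.card f.ker := by
    rw [← Nat.card_prod]
    have hmem (z : {y // Q y} × f.ker) : Q (f (Function.surjInv hf z.1.1 + z.2.1)) := by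
      rw [map_add, f.mem_ker.1 z.2.2, add_zero, Function.surjInv_eq hf]
      exact z.1.2
    refine (Nat.card_eq_of_bijective
      (fun z => (⟨Function.surjInv hf z.1.1 + z.2.1, hmem z⟩ : {x // Q (f x)})) ⟨?_, ?_⟩).symm
    · rintro ⟨⟨y, hy⟩, ⟨k, hk⟩⟩ ⟨⟨y', hy'⟩, ⟨k', hk'⟩⟩ h
      simp only [Subtype.mk.injEq] at h
      have h' := congrArg f h
      rw [map_add, map_add, f.mem_ker.1 hk, f.mem_ker.1 hk', Function.surjInv_eq hf,
        Function.surjInv_eq hf, add_zero, add_zero] at h'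
      subst h'
      simpa using h
    · rintro ⟨x, hx⟩
      refine ⟨⟨⟨f x, hx⟩, ⟨-Function.surjInv hf (f x) + x, ?_⟩⟩, ?_⟩
      · simp [f.mem_ker, Function.surjInv_eq hf]
      · simp
  have htop := fib fun _ => True
  rw [Nat.card_congr (Equiv.subtypeUnivEquiv fun _ => trivial),
    Nat.card_congr (Equiv.subtypeUnivEquiv fun _ => trivial)] at htop
  rw [fib P, htop]
  ring

theorem isUnit_iff_isUnit_castHom {p e : ℕ} (hp : p.Prime) (he : e ≠ 0) (x : ZMod (p ^ e)) :
    IsUnit x ↔ IsUnit (ZMod.castHom (dvd_pow_self p he) (ZMod p) x) := by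
  have : NeZero (p ^ e) := ⟨pow_ne_zero _ hp.ne_zero⟩
  obtain ⟨m, rfl⟩ := ZMod.natCast_zmod_surjective x
  rw [map_natCast, ZMod.isUnit_iff_coprime, ZMod.isUnit_iff_coprime,
    Nat.coprime_pow_right_iff (Nat.pos_of_ne_zero he)]

theorem card_rowData_zmod_prime (p : ℕ) (hp : p.Prime) (hp5 : 5 ≤ p) :
    Nat.card {x : ZMod p × ZMod p // RowData (ZMod p) x} = (p - 3) * (p - 5) := by
  classical
  have : Fact p.Prime := ⟨hp⟩
  have h11 : (1 : ZMod p) ≠ -1 := by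
    have : Fact (2 < p) := ⟨by omega⟩
    exact (ZMod.neg_one_ne_one).symm
  have key (x : ZMod p × ZMod p) : RowData (ZMod p) x ↔
      x.1 ∈ ({0, 1, -1} : Finset (ZMod p))ᶜ ∧
        x.2 ∈ ({0, 1, -1, x.1, x.1⁻¹} : Finset (ZMod p))ᶜ := by
    obtain ⟨a, s⟩ := x
    simp only [RowData, isUnit_iff_ne_zero, Finset.mem_compl, Finset.mem_insert,
      Finset.mem_singleton, not_or, ne_eq, sub_eq_zero, sq_eq_one_iff, eq_comm (a := (1 : ZMod p))
      (b := a ^ 2)]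
    by_cases ha : a = 0
    · simp [ha]
    · rw [← mul_eq_one_iff_eq_inv₀ ha, mul_comm s a]
      tauto
  have h3 : (({0, 1, -1} : Finset (ZMod p))ᶜ).card = p - 3 := by
    rw [Finset.card_compl, ZMod.card, Finset.card_eq_three.2 ⟨0, 1, -1, by simp, by simp, h11, rfl⟩]
  have h5 (a : ZMod p) (ha : a ∈ ({0, 1, -1} : Finset (ZMod p))ᶜ) :
      (({0, 1, -1, a, a⁻¹} : Finset (ZMod p))ᶜ).card = p - 5 := by
    simp only [Finset.mem_compl, Finset.mem_insert, Finset.mem_singleton, not_or] at ha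
    obtain ⟨h0, h1, hm⟩ := ha
    have hinv : a ≠ a⁻¹ := by
      rw [ne_eq, ← mul_eq_one_iff_eq_inv₀ h0, ← sq, sq_eq_one_iff]
      tauto
    have hm' : (-1 : ZMod p) ≠ a⁻¹ := fun h => hm (by rw [← inv_inv a, ← h, inv_neg, inv_one])
    have h1' : (1 : ZMod p) ≠ a⁻¹ := fun h => h1 (by rw [← inv_inv a, ← h, inv_one])
    rw [Finset.card_compl, ZMod.card]
    congr 1
    rw [Finset.card_insert_of_notMem, Finset.card_insert_of_notMem, Finset.card_insert_of_notMem,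
      Finset.card_pair hinv]
    · simp [hm', Ne.symm hm]
    · simp [h11, h1', Ne.symm h1]
    · simp [Ne.symm h0, eq_comm (a := (0 : ZMod p)), h0]
  let S : Finset (Σ _ : ZMod p, ZMod p) :=
    ({0, 1, -1} : Finset (ZMod p))ᶜ.sigma fun a => ({0, 1, -1, a, a⁻¹} : Finset (ZMod p))ᶜ
  have hS : Nat.card {x : ZMod p × ZMod p // RowData (ZMod p) x} = Nat.card S := by
    refine Nat.card_congr ((Equiv.sigmaEquivProd _ _).symm.subtypeEquiv fun x => ?_)
    rw [key, Finset.mem_sigma]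
    rfl
  rw [hS, Nat.card_eq_fintype_card, Fintype.card_coe, Finset.card_sigma, Finset.sum_congr rfl h5,
    Finset.sum_const, h3, smul_eq_mul]

/-- The number of involutions in `𝔉_{p^e}` is `p^(2e-2)(p-3)(p-5)`. -/
theorem card_involutions_Frak (p : ℕ) (hp : p.Prime) (hp5 : 5 ≤ p) (e : ℕ) (he : 1 ≤ e) :
    Nat.card {A : Matrix (Fin 2) (Fin 2) (ZMod (p ^ e)) // Frak (p ^ e) A ∧ A * A = 1} =
      p ^ (2 * e - 2) * (p - 3) * (p - 5) := by
  have he0 : e ≠ 0 := by omega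
  have : NeZero (p ^ e) := ⟨pow_ne_zero _ hp.ne_zero⟩
  have : NeZero p := ⟨hp.ne_zero⟩
  let f := ZMod.castHom (dvd_pow_self p he0) (ZMod p)
  have hf : Function.Surjective f := ZMod.castHom_surjective _
  have hR (x : ZMod (p ^ e) × ZMod (p ^ e)) :
      RowData (ZMod (p ^ e)) x ↔ RowData (ZMod p) (f.toAddMonoidHom.prodMap f.toAddMonoidHom x) := by
    simp only [RowData, isUnit_iff_isUnit_castHom hp he0, map_sub, map_mul, map_pow, map_one]
    rfl
  have h := card_subtype_comp_mul_card (f.toAddMonoidHom.prodMap f.toAddMonoidHom)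
    (hf.prodMap hf) (RowData (ZMod p))
  rw [card_rowData_zmod_prime p hp hp5, Nat.card_prod, Nat.card_prod, Nat.card_zmod,
    Nat.card_zmod] at h
  rw [card_involutions_eq_card_rowData, Nat.card_congr (Equiv.subtypeEquivRight hR)]
  refine Nat.eq_of_mul_eq_mul_right (Nat.mul_pos hp.pos hp.pos) (h.trans ?_)
  obtain ⟨k, rfl⟩ : ∃ k, e = k + 1 := ⟨e - 1, by omega⟩
  rw [show 2 * (k + 1) - 2 = 2 * k by omega]
  ring
end

section
/- Let n > 1 be coprime to 6, with prime factorization n = p₁^{e₁}···p_s^{e_s}. Then the number Θ(n) of equivalence classes of 𝔉_n under the relation ~ satisfies 72·Θ(n) = |𝔉_n| + 4·∏_{i=1}^{s} θ₂(p_i, e_i) + 6·∏_{i=1}^{s} p_i^{2e_i−2}(p_i−3)(p_i−5) + 12·∏_{i=1}^{s} θ₄(p_i), where θ₂(p,e) = p^{2e−2}(p−1)(p−2) if p ≡ 2 (mod 3) and θ₂(p,e) = p^{2e−2}(p−1)(p−4) if p ≡ 1 (mod 3), and θ₄(p) = 0 if p ≡ 2 (mod 3) and θ₄(p) = 2 if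 p ≡ 1 (mod 3). -/
open Matrix

/-- The matrix `M₁ = [[-1,1],[-1,0]]` as an element of `GL₂(ℤ/nℤ)`. -/
noncomputable def M1 (n : ℕ) : GL (Fin 2) (ZMod n) :=
  Matrix.nonsingInvUnit !![-1, 1; -1, 0] (by simp [Matrix.det_fin_two_of])

/-- The matrix `M₂ = [[0,1],[1,0]]` as an element of `GL₂(ℤ/nℤ)`. -/
noncomputable def M2 (n : ℕ) : GL (Fin 2) (ZMod n) :=
  Matrix.nonsingInvUnit !![0, 1; 1, 0] (by simp [Matrix.det_fin_two_of])

/-- The copy of `S₃` inside `GL₂(ℤ/nℤ)` generated by `M₁` and `M₂`. -/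
noncomputable def Sgrp (n : ℕ) : Subgroup (GL (Fin 2) (ZMod n)) :=
  Subgroup.closure {M1 n, M2 n}

/-- The relation `A ~ B` on matrices over `ℤ/nℤ`: `B = Q·A·P` or `B = Q·A⁻¹·P`
for some `P, Q` in the copy `S` of `S₃`. -/
noncomputable def BRel (n : ℕ) (A B : Matrix (Fin 2) (Fin 2) (ZMod n)) : Prop :=
  ∃ P Q : GL (Fin 2) (ZMod n), P ∈ Sgrp n ∧ Q ∈ Sgrp n ∧
    (B = (Q : Matrix (Fin 2) (Fin 2) (ZMod n)) * A * (P : Matrix (Fin 2) (Fin 2) (ZMod n)) ∨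
     B = (Q : Matrix (Fin 2) (Fin 2) (ZMod n)) * A⁻¹ * (P : Matrix (Fin 2) (Fin 2) (ZMod n)))

/-- `Θ(n)`: the number of equivalence classes of `𝔉ₙ` under `~`. -/
noncomputable def Theta (n : ℕ) : ℕ :=
  Nat.card (Quot (fun A B : {A : Matrix (Fin 2) (Fin 2) (ZMod n) // Frak n A} => BRel n A.1 B.1))

section Counting

theorem natCard_subtype_comp_addMonoidHom {G H : Type*} [AddGroup G] [AddGroup H] (f : G →+ H)
    (hf : Function.Surjective f) (P : H → Prop) :
    Nat.card {x // P (f x)} = Nat.card {y // P y} * Nat.card f.ker := by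
  rw [← Nat.card_prod]
  have hg := Function.surjInv_eq hf
  refine Nat.card_congr
    { toFun := fun x => (⟨f x, x.2⟩, ⟨x - Function.surjInv hf (f x), by simp [f.mem_ker, hg]⟩)
      invFun := fun z => ⟨z.2 + Function.surjInv hf z.1, by
        have := z.2.2
        rw [f.mem_ker] at this
        simpa [this, hg] using z.1.2⟩
      left_inv := fun x => by simp
      right_inv := fun z => by
        have := z.2.2
        rw [f.mem_ker] at this
        ext <;> simp [this, hg] }

theorem ZMod.isUnit_iff_castHom_ne_zero {p e : ℕ} (hp : p.Prime) (he : e ≠ 0) (x : ZMod (p ^ e)) :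
    IsUnit x ↔ ZMod.castHom (dvd_pow_self p he) (ZMod p) x ≠ 0 := by
  have : NeZero (p ^ e) := ⟨pow_ne_zero _ hp.ne_zero⟩
  obtain ⟨a, rfl⟩ := ZMod.natCast_zmod_surjective x
  rw [ZMod.isUnit_natCast_iff_not_dvd_pow hp (Nat.pos_of_ne_zero he), map_natCast, Ne,
    ZMod.natCast_eq_zero_iff]

theorem natCard_pi_subtype_of_multiplicative {σ : Type} [Finite σ]
    (P : ∀ (R : Type) [CommRing R], (σ → R) → Prop)
    (hone : ∀ v, P (ZMod 1) v)
    (hprod : ∀ (R S T : Type) [CommRing R] [CommRing S] [CommRing T] (e : R ≃+* S × T) (v : σ → R),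
      P R v ↔ P S (fun i => (e (v i)).1) ∧ P T (fun i => (e (v i)).2))
    {n : ℕ} (hn : n ≠ 0) :
    Nat.card {v // P (ZMod n) v} =
      ∏ p ∈ n.primeFactors, Nat.card {v // P (ZMod (p ^ n.factorization p)) v} := by
  refine Nat.multiplicative_factorization (fun n => Nat.card {v // P (ZMod n) v}) ?_ ?_ hn
  · intro x y hxy
    rw [← Nat.card_prod]
    let e := ZMod.chineseRemainder hxy
    refine Nat.card_congr
      { toFun := fun v => (⟨fun i => (e (v.1 i)).1, ((hprod _ _ _ e v.1).1 v.2).1⟩,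
          ⟨fun i => (e (v.1 i)).2, ((hprod _ _ _ e v.1).1 v.2).2⟩)
        invFun := fun z => ⟨fun i => e.symm (z.1.1 i, z.2.1 i), by
          rw [hprod _ _ _ e]
          simpa using ⟨z.1.2, z.2.2⟩⟩
        left_inv := fun v => by simp
        right_inv := fun z => by simp }
  · have : Unique {v // P (ZMod 1) v} :=
      ⟨⟨⟨0, hone 0⟩⟩, fun v => Subtype.ext (Subsingleton.elim (α := σ → Fin 1) _ _)⟩
    exact Nat.card_unique

theorem MvPolynomial.map_aeval_int {σ R S : Type*} [CommRing R] [CommRing S] (φ : R →+* S)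
    (f : MvPolynomial σ ℤ) (v : σ → R) :
    φ (aeval v f) = aeval (fun i => φ (v i)) f := by
  rw [map_aeval, RingHom.ext_int (φ.comp _) (algebraMap ℤ S)]
  rfl

theorem ZMod.natCard_isUnit_aeval_prime_pow {σ : Type} [Fintype σ] (f : MvPolynomial σ ℤ)
    {p e : ℕ} (hp : p.Prime) (he : e ≠ 0) :
    Nat.card {v : σ → ZMod (p ^ e) // IsUnit (MvPolynomial.aeval v f)} =
      Nat.card {v : σ → ZMod p // MvPolynomial.aeval v f ≠ 0} * p ^ ((e - 1) * Fintype.card σ) := by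
  have : NeZero p := ⟨hp.ne_zero⟩
  let φ := ZMod.castHom (dvd_pow_self p he) (ZMod p)
  let F : (σ → ZMod (p ^ e)) →+ (σ → ZMod p) := φ.toAddMonoidHom.compLeft σ
  have hF : Function.Surjective F := (ZMod.castHom_surjective (dvd_pow_self p he)).comp_left
  have key := natCard_subtype_comp_addMonoidHom F hF
  have hker : Nat.card F.ker = p ^ ((e - 1) * Fintype.card σ) := by
    have h := key fun _ => True
    simp only [Nat.card_congr (Equiv.subtypeUnivEquiv fun _ => trivial), Nat.card_fun,
      Nat.card_zmod, Nat.card_eq_fintype_card (α := σ)] at h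
    have hpos : 0 < p ^ Fintype.card σ := pow_pos hp.pos _
    refine Nat.eq_of_mul_eq_mul_left hpos (h.symm.trans ?_)
    rw [← pow_mul, ← pow_add]
    obtain ⟨k, rfl⟩ := Nat.exists_eq_succ_of_ne_zero he
    congr 1
    simp
    ring
  rw [← hker, ← key fun v => MvPolynomial.aeval v f ≠ 0]
  refine Nat.card_congr (Equiv.subtypeEquivRight fun v => ?_)
  rw [ZMod.isUnit_iff_castHom_ne_zero hp he, MvPolynomial.map_aeval_int]
  rfl

theorem ZMod.natCard_isUnit_aeval (f : MvPolynomial (Fin 2) ℤ) {n : ℕ} (hn : n ≠ 0) :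
    Nat.card {v : Fin 2 → ZMod n // IsUnit (MvPolynomial.aeval v f)} =
      ∏ p ∈ n.primeFactors, p ^ (2 * n.factorization p - 2) *
        Nat.card {v : Fin 2 → ZMod p // MvPolynomial.aeval v f ≠ 0} := by
  rw [natCard_pi_subtype_of_multiplicative (fun R _ v => IsUnit (MvPolynomial.aeval v f)) _ _ hn]
  · refine Finset.prod_congr rfl fun p hp => ?_
    have hp' := Nat.prime_of_mem_primeFactors hp
    have he : n.factorization p ≠ 0 :=
      (hp'.factorization_pos_of_dvd hn (Nat.dvd_of_mem_primeFactors hp)).ne'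
    rw [ZMod.natCard_isUnit_aeval_prime_pow f hp' he, mul_comm, Fintype.card_fin]
    congr 2
    omega
  · intro v
    exact isUnit_of_subsingleton (M := Fin 1) _
  · intro R S T _ _ _ e v
    rw [← MulEquiv.isUnit_map e, Prod.isUnit_iff]
    have h1 := MvPolynomial.map_aeval_int ((RingHom.fst S T).comp (e : R →+* S × T)) f v
    have h2 := MvPolynomial.map_aeval_int ((RingHom.snd S T).comp (e : R →+* S × T)) f v
    simp only [RingHom.comp_apply, RingHom.coe_coe, RingHom.coe_fst, RingHom.coe_snd] at h1 h2
    rw [h1, h2]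

end Counting

section Roots

theorem ZMod.natCast_ne_zero_of_lt {p m : ℕ} (hm : m ≠ 0) (hlt : m < p) :
    (m : ZMod p) ≠ 0 := by
  rw [Ne, ZMod.natCast_eq_zero_iff]
  exact Nat.not_dvd_of_pos_of_lt (Nat.pos_of_ne_zero hm) hlt

theorem ZMod.natCard_roots_prime_pow {p e : ℕ} (hp : p.Prime) (h5 : 5 ≤ p) (he : e ≠ 0) :
    Nat.card {t : ZMod (p ^ e) // t ^ 2 - t + 1 = 0} = if p % 3 = 1 then 2 else 0 := by
  have : Fact p.Prime := ⟨hp⟩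
  have : NeZero (p ^ e) := ⟨pow_ne_zero _ hp.ne_zero⟩
  have h3 : (3 : ZMod p) ≠ 0 := by
    exact_mod_cast ZMod.natCast_ne_zero_of_lt (p := p) (m := 3) (by omega) (by omega)
  have hunit := ZMod.isUnit_iff_castHom_ne_zero hp he
  set φ := ZMod.castHom (dvd_pow_self p he) (ZMod p)
  split_ifs with hp3
  · obtain ⟨w, hw⟩ : ∃ w : (ZMod (p ^ e))ˣ, orderOf w = 3 := by
      refine exists_prime_orderOf_dvd_card 3 ?_
      rw [ZMod.card_units_eq_totient, Nat.totient_prime_pow hp (Nat.pos_of_ne_zero he)]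
      exact Dvd.dvd.mul_left (by omega) _
    have hw1 : (w : ZMod (p ^ e)) ≠ 1 := fun h => by
      rw [Units.val_eq_one] at h
      simp [h] at hw
    have hw3 : (w : ZMod (p ^ e)) ^ 3 = 1 := by
      rw [← Units.val_pow_eq_pow_val, ← hw, pow_orderOf_eq_one, Units.val_one]
    have hmul : ((w : ZMod (p ^ e)) - 1) * (w ^ 2 + w + 1) = 0 := by linear_combination hw3
    have hroot : (w : ZMod (p ^ e)) ^ 2 + w + 1 = 0 := by
      by_cases hu : IsUnit ((w : ZMod (p ^ e)) - 1)
      · exact hu.mul_right_eq_zero.1 hmul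
      · rw [hunit, not_not, map_sub, map_one, sub_eq_zero] at hu
        have hu' : IsUnit ((w : ZMod (p ^ e)) ^ 2 + w + 1) := by
          rw [hunit]
          simp only [map_add, map_pow, map_one, hu]
          intro h
          exact h3 (by linear_combination h)
        exact absurd (sub_eq_zero.1 (hu'.mul_left_eq_zero.1 hmul)) hw1
    have hset : {t : ZMod (p ^ e) | t ^ 2 - t + 1 = 0} =
        {-(w : ZMod (p ^ e)), 1 + (w : ZMod (p ^ e))} := by
      ext t
      simp only [Set.mem_ofPred_eq, Set.mem_insert_iff, Set.mem_singleton_iff]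
      constructor
      · intro ht
        have hprod : (t + w) * (t - (1 + (w : ZMod (p ^ e)))) = 0 := by
          linear_combination ht - hroot
        by_cases hu : IsUnit (t + w)
        · exact .inr (sub_eq_zero.1 (hu.mul_right_eq_zero.1 hprod))
        · left
          by_cases hu' : IsUnit (t - (1 + (w : ZMod (p ^ e))))
          · exact eq_neg_of_add_eq_zero_left (hu'.mul_left_eq_zero.1 hprod)
          · rw [hunit, not_not] at hu hu'
            have ht' := congrArg φ ht
            simp only [map_add, map_sub, map_pow, map_one, map_zero] at ht' hu hu'
            exact absurd (by linear_combination 4 * ht' - (2 * φ t - 1) * (hu + hu')) h3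
      · rintro (rfl | rfl)
        · linear_combination hroot
        · linear_combination hroot
    have hne : -(w : ZMod (p ^ e)) ≠ 1 + (w : ZMod (p ^ e)) := fun h => by
      have h' := congrArg φ h
      have hr := congrArg φ hroot
      simp only [map_add, map_neg, map_pow, map_one, map_zero] at h' hr
      exact h3 (by linear_combination 4 * hr + (2 * φ w + 1) * h')
    exact (congrArg Set.ncard hset).trans (Set.ncard_pair hne)
  · rw [Nat.card_eq_zero]
    refine .inl ⟨fun ⟨t, ht⟩ => hp3 ?_⟩
    have ht' := congrArg φ ht
    simp only [map_add, map_sub, map_pow, map_one, map_zero] at ht'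
    have hord : orderOf (-φ t) = 3 := by
      refine orderOf_eq_prime (by linear_combination (-φ t - 1) * ht') fun h => h3 ?_
      linear_combination ht' - (φ t - 2) * (-h)
    have hdvd := ZMod.orderOf_dvd_card_sub_one (p := p) (a := -φ t) (by
      intro h
      simp [h] at hord)
    rw [hord] at hdvd
    omega

theorem Nat.five_le_of_mem_primeFactors {n p : ℕ} (h6 : Nat.Coprime n 6)
    (hp : p ∈ n.primeFactors) : 5 ≤ p := by
  have hp' := Nat.prime_of_mem_primeFactors hp
  have hc : Nat.Coprime p 6 := h6.coprime_dvd_left (Nat.dvd_of_mem_primeFactors hp)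
  by_contra! hlt
  interval_cases p <;> revert hc hp' <;> decide

theorem ZMod.natCard_roots {n : ℕ} (hn : n ≠ 0) (h6 : Nat.Coprime n 6) :
    Nat.card {t : ZMod n // t ^ 2 - t + 1 = 0} =
      ∏ p ∈ n.primeFactors, if p % 3 = 1 then 2 else 0 := by
  have hcongr (m : ℕ) : Nat.card {v : Unit → ZMod m // v () ^ 2 - v () + 1 = 0} =
      Nat.card {t : ZMod m // t ^ 2 - t + 1 = 0} :=
    Nat.card_congr ((Equiv.funUnique Unit (ZMod m)).subtypeEquiv fun _ => Iff.rfl)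
  refine (hcongr n).symm.trans ((natCard_pi_subtype_of_multiplicative
    (fun R _ (v : Unit → R) => v () ^ 2 - v () + 1 = 0) ?_ ?_ hn).trans ?_)
  · exact fun v => Subsingleton.elim (α := Fin 1) _ _
  · intro R S T _ _ _ e v
    rw [← e.map_eq_zero_iff, Prod.ext_iff]
    simp
  · refine Finset.prod_congr rfl fun p hp => ?_
    have hp' := Nat.prime_of_mem_primeFactors hp
    exact (hcongr _).trans (ZMod.natCard_roots_prime_pow hp'
      (Nat.five_le_of_mem_primeFactors h6 hp)
      (hp'.factorization_pos_of_dvd hn (Nat.dvd_of_mem_primeFactors hp)).ne')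

end Roots

section FieldCounts

variable {K : Type*} [Field K] [Finite K]

theorem natCard_pairs_eisenstein {r : ℕ} (hr : Nat.card {t : K // t ^ 2 - t + 1 = 0} = r) :
    Nat.card {v : Fin 2 → K //
        v 0 * v 1 * (v 0 - v 1) * (v 0 ^ 2 - v 0 * v 1 + v 1 ^ 2) ≠ 0} =
      (Nat.card K - 1) * (Nat.card K - (2 + r)) := by
  classical
  have := Fintype.ofFinite K
  have h1 : Nat.card {y : K // y ≠ 0} = Nat.card K - 1 := by
    simp [Nat.card_eq_fintype_card, Fintype.card_subtype_compl]
  have h2 : Nat.card {t : K // t * (t - 1) * (t ^ 2 - t + 1) ≠ 0} = Nat.card K - (2 + r) := by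
    rw [Nat.card_eq_fintype_card, Nat.card_eq_fintype_card, Fintype.card_subtype_compl, ← hr,
      Nat.card_eq_fintype_card, Fintype.card_subtype, Fintype.card_subtype]
    congr 1
    rw [← Finset.card_pair (zero_ne_one' K), ← Finset.card_union_of_disjoint]
    · congr 1
      ext t
      simp [sub_eq_zero, or_assoc]
    · rw [Finset.disjoint_left]
      intro t ht
      simp only [Finset.mem_insert, Finset.mem_singleton] at ht
      rcases ht with rfl | rfl <;> simp
  rw [← h1, ← h2, ← Nat.card_prod]
  refine Nat.card_congr
    { toFun := fun v =>
        have hy : v.1 1 ≠ 0 := fun h => v.2 (by simp [h])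
        (⟨v.1 1, hy⟩, ⟨v.1 0 / v.1 1, fun h => v.2 (by
          have hxy : v.1 0 = v.1 0 / v.1 1 * v.1 1 := (div_mul_cancel₀ _ hy).symm
          rw [hxy]
          linear_combination v.1 1 ^ 5 * h)⟩)
      invFun := fun z => ⟨![z.2.1 * z.1.1, z.1.1], fun h => z.2.2 (by
        have hy := z.1.2
        have : z.1.1 ^ 5 * (z.2.1 * (z.2.1 - 1) * (z.2.1 ^ 2 - z.2.1 + 1)) = 0 := by
          simp only [Matrix.cons_val_zero, Matrix.cons_val_one] at h
          linear_combination h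
        exact (mul_eq_zero.1 this).resolve_left (pow_ne_zero _ hy))⟩
      left_inv := fun v => by
        have hy : v.1 1 ≠ 0 := fun h => v.2 (by simp [h])
        ext i
        fin_cases i <;> simp [hy]
      right_inv := fun z => by
        have hy := z.1.2
        ext <;> simp [hy] }

theorem natCard_pairs_involution (h2 : (2 : K) ≠ 0) :
    Nat.card {v : Fin 2 → K //
        v 0 * v 1 * (v 0 - v 1) * (1 - v 0 ^ 2) * (1 - v 1 ^ 2) * (1 - v 0 * v 1) ≠ 0} =
      (Nat.card K - 3) * (Nat.card K - 5) := by
  classical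
  have := Fintype.ofFinite K
  let A : Finset K := {0, 1, -1}ᶜ
  let B (a : K) : Finset K := {0, 1, -1, a, a⁻¹}ᶜ
  have hneg : (1 : K) ≠ -1 := fun h => h2 (by linear_combination h)
  have hA : A.card = Nat.card K - 3 := by
    rw [Finset.card_compl, Nat.card_eq_fintype_card]
    congr 1
    rw [Finset.card_eq_three]
    exact ⟨0, 1, -1, by simp, by simp, hneg, rfl⟩
  have hB (a : K) (ha : a ∈ A) : (B a).card = Nat.card K - 5 := by
    simp only [A, Finset.mem_compl, Finset.mem_insert, Finset.mem_singleton, not_or] at ha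
    obtain ⟨h0, h1, hm1⟩ := ha
    have haa : a ≠ a⁻¹ := fun h => by
      rcases mul_self_eq_one_iff.1 ((congrArg (a * ·) h).trans (mul_inv_cancel₀ h0)) with h | h
      exacts [h1 h, hm1 h]
    have hm1' : (-1 : K) ≠ a⁻¹ := fun h => hm1 (by rw [← inv_inv a, ← h]; norm_num)
    have h1' : (1 : K) ≠ a⁻¹ := fun h => h1 (by rw [← inv_inv a, ← h, inv_one])
    rw [Finset.card_compl, Nat.card_eq_fintype_card]
    congr 1
    repeat rw [Finset.card_insert_of_notMem]
    · simp
    all_goals simp [Ne.symm h0, Ne.symm h1, Ne.symm hm1, hneg, hm1', h1', haa]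
  rw [← hA, ← smul_eq_mul, ← Finset.sum_const, ← Finset.sum_congr rfl hB, ← Finset.card_sigma,
    ← Fintype.card_coe, ← Nat.card_eq_fintype_card]
  let E : (Fin 2 → K) ≃ (Σ _ : K, K) :=
    ⟨fun v => ⟨v 0, v 1⟩, fun z => ![z.1, z.2],
      fun v => funext (Fin.forall_fin_two.2 ⟨rfl, rfl⟩), fun z => rfl⟩
  refine Nat.card_congr (E.subtypeEquiv fun v => ?_)
  · change _ ↔ (⟨v 0, v 1⟩ : Σ _ : K, K) ∈ A.sigma B
    have key (x y : K) (hx : x ≠ 0) : y = x⁻¹ ↔ 1 - x * y = 0 := by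
      rw [sub_eq_zero, eq_comm (a := 1), ← mul_one x⁻¹, eq_inv_mul_iff_mul_eq₀ hx]
    have hsq (x : K) : 1 - x ^ 2 = 0 ↔ x = 1 ∨ x = -1 := by
      rw [sub_eq_zero, eq_comm, sq_eq_one_iff]
    simp only [ne_eq, mul_eq_zero, not_or, hsq, Finset.mem_sigma, A, B,
      Finset.mem_compl, Finset.mem_insert, Finset.mem_singleton, sub_eq_zero (a := v 0)]
    by_cases h0 : v 0 = 0
    · simp [h0]
    · rw [key _ _ h0, eq_comm (a := v 1) (b := v 0)]
      tauto

end FieldCounts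

section Representation

open DihedralGroup

theorem DihedralGroup.three_induction {C : DihedralGroup 3 → Prop} (one : C 1)
    (r_mul : ∀ a, C a → C (r 1 * a)) (sr_mul : ∀ a, C a → C (sr 0 * a)) (d : DihedralGroup 3) :
    C d := by
  have h0 : C (r 0) := one
  have h1 : C (r 1) := r_mul _ h0
  have h2 : C (r 2) := r_mul _ h1
  rcases d with i | i <;> fin_cases i
  exacts [h0, h1, h2, sr_mul _ h0, sr_mul _ h1, sr_mul _ h2]

/-- The two-dimensional integral representation of `S₃`, seen as the dihedral group of order 6. -/
def intRep : DihedralGroup 3 →* Matrix (Fin 2) (Fin 2) ℤ where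
  toFun
    | r i => ![!![1, 0; 0, 1], !![-1, 1; -1, 0], !![0, -1; 1, -1]] i
    | sr i => ![!![0, 1; 1, 0], !![-1, 0; -1, 1], !![1, -1; 0, -1]] i
  map_one' := by decide
  map_mul' := by decide

/-- The reduction of `intRep` modulo `n`. -/
def modRep (n : ℕ) : DihedralGroup 3 →* GL (Fin 2) (ZMod n) :=
  (((Int.castRingHom (ZMod n)).mapMatrix : _ →+* _).toMonoidHom.comp intRep).toHomUnits

theorem coe_modRep (n : ℕ) (d : DihedralGroup 3) :
    (modRep n d : Matrix (Fin 2) (Fin 2) (ZMod n)) = (intRep d).map (Int.castRingHom (ZMod n)) :=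
  rfl

theorem coe_modRep_r_one (n : ℕ) :
    (modRep n (r 1) : Matrix (Fin 2) (Fin 2) (ZMod n)) = !![-1, 1; -1, 0] := by
  rw [coe_modRep]
  ext i j
  fin_cases i <;> fin_cases j <;> simp [intRep]

theorem coe_modRep_sr_zero (n : ℕ) :
    (modRep n (sr 0) : Matrix (Fin 2) (Fin 2) (ZMod n)) = !![0, 1; 1, 0] := by
  rw [coe_modRep]
  ext i j
  fin_cases i <;> fin_cases j <;> simp [intRep]

theorem modRep_injective {n : ℕ} (hn : 1 < n) : Function.Injective (modRep n) := by
  have : Fact (1 < n) := ⟨hn⟩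
  rw [injective_iff_map_eq_one]
  intro d hd
  have hd' := congrArg Units.val hd
  rw [coe_modRep] at hd'
  have h01 := congrFun₂ hd' 0 1
  have h10 := congrFun₂ hd' 1 0
  rcases d with i | i <;> fin_cases i <;> simp [intRep] at h01 h10 ⊢
  rfl

theorem Sgrp_eq_range (n : ℕ) : Sgrp n = (modRep n).range := by
  have h1 : M1 n = modRep n (r 1) := Units.ext (coe_modRep_r_one n).symm
  have h2 : M2 n = modRep n (sr 0) := Units.ext (coe_modRep_sr_zero n).symm
  refine le_antisymm ((Subgroup.closure_le _).2 ?_) ?_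
  · rintro _ (rfl | rfl)
    exacts [⟨_, h1.symm⟩, ⟨_, h2.symm⟩]
  · rintro _ ⟨d, rfl⟩
    refine three_induction (C := fun d => modRep n d ∈ Sgrp n) ?_ (fun a ha => ?_)
      (fun a ha => ?_) d
    · rw [map_one]
      exact one_mem _
    · rw [map_mul, ← h1]
      exact mul_mem (Subgroup.subset_closure (by simp)) ha
    · rw [map_mul, ← h2]
      exact mul_mem (Subgroup.subset_closure (by simp)) ha

end Representation

section Stability

open DihedralGroup

variable {n : ℕ} {A : Matrix (Fin 2) (Fin 2) (ZMod n)}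

theorem Frak.isUnit_det (hA : Frak n A) : IsUnit A.det := by
  rw [Matrix.det_fin_two]
  exact hA.1

theorem frak_of {a b c d : ZMod n} :
    Frak n !![a, b; c, d] ↔ IsUnit (a * d - b * c) ∧ IsUnit a ∧ IsUnit b ∧ IsUnit c ∧ IsUnit d ∧
      IsUnit (a + b) ∧ IsUnit (c + d) ∧ IsUnit (a - c) ∧ IsUnit (b - d) ∧
      IsUnit (a + b - c - d) :=
  Iff.rfl

theorem Frak.r_one_mul (hA : Frak n A) : Frak n (!![-1, 1; -1, 0] * A) := by
  rw [Matrix.eta_fin_two A, frak_of] at hA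
  obtain ⟨h1, h2, h3, h4, h5, h6, h7, h8, h9, h10⟩ := hA
  rw [Matrix.eta_fin_two A, Matrix.mul_fin_two, frak_of]
  refine ⟨?_, ?_, ?_, ?_, ?_, ?_, ?_, ?_, ?_, ?_⟩
  · convert h1 using 1; ring
  · convert h8.neg using 1; ring
  · convert h9.neg using 1; ring
  · convert h2.neg using 1; ring
  · convert h3.neg using 1; ring
  · convert h10.neg using 1; ring
  · convert h6.neg using 1; ring
  · convert h4 using 1; ring
  · convert h5 using 1; ring
  · convert h7 using 1; ring

theorem Frak.sr_zero_mul (hA : Frak n A) : Frak n (!![0, 1; 1, 0] * A) := by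
  rw [Matrix.eta_fin_two A, frak_of] at hA
  obtain ⟨h1, h2, h3, h4, h5, h6, h7, h8, h9, h10⟩ := hA
  rw [Matrix.eta_fin_two A, Matrix.mul_fin_two, frak_of]
  refine ⟨?_, ?_, ?_, ?_, ?_, ?_, ?_, ?_, ?_, ?_⟩
  · convert h1.neg using 1; ring
  · convert h4 using 1; ring
  · convert h5 using 1; ring
  · convert h2 using 1; ring
  · convert h3 using 1; ring
  · convert h7 using 1; ring
  · convert h6 using 1; ring
  · convert h8.neg using 1; ring
  · convert h9.neg using 1; ring
  · convert h10.neg using 1; ring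

theorem Frak.smul {u : ZMod n} (hu : IsUnit u) (hA : Frak n A) : Frak n (u • A) := by
  simp only [Frak, Matrix.smul_apply, smul_eq_mul, ← mul_add, ← mul_sub]
  obtain ⟨h1, h2, h3, h4, h5, h6, h7, h8, h9, h10⟩ := hA
  refine ⟨?_, hu.mul h2, hu.mul h3, hu.mul h4, hu.mul h5, hu.mul h6, hu.mul h7, hu.mul h8,
    hu.mul h9, hu.mul h10⟩
  convert (hu.mul hu).mul h1 using 1
  ring

theorem Frak.inv (hA : Frak n A) : Frak n A⁻¹ := by
  rw [Matrix.inv_def]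
  refine Frak.smul hA.isUnit_det.ringInverse ?_
  obtain ⟨h1, h2, h3, h4, h5, h6, h7, h8, h9, h10⟩ := hA
  rw [Matrix.adjugate_fin_two, frak_of]
  refine ⟨?_, h5, h3.neg, h4.neg, h2, ?_, ?_, ?_, ?_, ?_⟩
  · convert h1 using 1; ring
  · convert h9.neg using 1; ring
  · convert h8 using 1; ring
  · convert h7 using 1; ring
  · convert h6.neg using 1; ring
  · convert h10.neg using 1; ring

theorem Frak.modRep_mul (q : DihedralGroup 3) (hA : Frak n A) : Frak n (modRep n q * A) := by
  induction q using three_induction with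
  | one => simpa
  | r_mul a h =>
    rw [map_mul, Units.val_mul, Matrix.mul_assoc, coe_modRep_r_one]
    exact h.r_one_mul
  | sr_mul a h =>
    rw [map_mul, Units.val_mul, Matrix.mul_assoc, coe_modRep_sr_zero]
    exact h.sr_zero_mul

theorem Frak.mul_modRep (p : DihedralGroup 3) (hA : Frak n A) : Frak n (A * modRep n p) := by
  have h := (hA.inv.modRep_mul p⁻¹).inv
  rwa [Matrix.mul_inv_rev, Matrix.nonsing_inv_nonsing_inv _ hA.isUnit_det, map_inv,
    Matrix.coe_units_inv, Matrix.nonsing_inv_nonsing_inv] at h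
  exact (Matrix.isUnit_iff_isUnit_det _).1 (modRep n p).isUnit

end Stability

section Action

open DihedralGroup

/-- The homomorphism from `ℤˣ` sending `-1` to an element of square one. -/
def involutionHom {M : Type*} [Monoid M] (a : M) (ha : a * a = 1) : ℤˣ →* M where
  toFun u := if u = 1 then 1 else a
  map_one' := if_pos rfl
  map_mul' u v := by
    rcases Int.units_eq_one_or u with rfl | rfl <;> rcases Int.units_eq_one_or v with rfl | rfl <;>
      simp [ha]

/-- The wreath product of `S₃` with the group of order two. -/
abbrev Wreath : Type :=
  (DihedralGroup 3 × DihedralGroup 3) ⋊[involutionHom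
    (MulEquiv.prodComm : MulAut (DihedralGroup 3 × DihedralGroup 3)) rfl] ℤˣ

/-- The set `𝔉ₙ` as a type. -/
abbrev FrakSet (n : ℕ) : Type := {A : Matrix (Fin 2) (Fin 2) (ZMod n) // Frak n A}

/-- The two-sided action of `S₃ × S₃` on `𝔉ₙ`. -/
def twoSidedHom (n : ℕ) : DihedralGroup 3 × DihedralGroup 3 →* Equiv.Perm (FrakSet n) :=
  MonoidHom.toHomPerm
    { toFun := fun g A => ⟨modRep n g.1 * A.1 * modRep n g.2⁻¹,
        (A.2.modRep_mul g.1).mul_modRep g.2⁻¹⟩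
      map_one' := by
        refine funext fun A => Subtype.ext ?_
        change modRep n 1 * A.1 * modRep n 1⁻¹ = A.1
        simp
      map_mul' := fun g h => by
        refine funext fun A => Subtype.ext ?_
        change modRep n (g.1 * h.1) * A.1 * modRep n (g.2 * h.2)⁻¹ =
          modRep n g.1 * (modRep n h.1 * A.1 * modRep n h.2⁻¹) * modRep n g.2⁻¹
        simp only [_root_.mul_inv_rev, map_mul, Units.val_mul, Matrix.mul_assoc] }

/-- Matrix inversion on `𝔉ₙ`. -/
noncomputable def frakInv (n : ℕ) : Equiv.Perm (FrakSet n) :=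
  Function.Involutive.toPerm (fun A => ⟨A.1⁻¹, A.2.inv⟩) fun A =>
    Subtype.ext (Matrix.nonsing_inv_nonsing_inv _ A.2.isUnit_det)

theorem frakInv_mul_self (n : ℕ) : frakInv n * frakInv n = 1 :=
  Equiv.ext fun A => Subtype.ext (Matrix.nonsing_inv_nonsing_inv _ A.2.isUnit_det)

theorem frakInv_conj_twoSidedHom (n : ℕ) (g : DihedralGroup 3 × DihedralGroup 3) :
    twoSidedHom n g.swap * frakInv n = frakInv n * twoSidedHom n g := by
  ext1 A
  apply Subtype.ext
  change modRep n g.2 * A.1⁻¹ * modRep n g.1⁻¹ = (modRep n g.1 * A.1 * modRep n g.2⁻¹)⁻¹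
  simp only [Matrix.mul_inv_rev, ← Matrix.coe_units_inv, map_inv, inv_inv, Matrix.mul_assoc]

/-- The permutation action of the wreath product on `𝔉ₙ`. -/
noncomputable def wreathHom (n : ℕ) : Wreath →* Equiv.Perm (FrakSet n) :=
  SemidirectProduct.lift (twoSidedHom n) (involutionHom (frakInv n) (frakInv_mul_self n)) fun u => by
    ext1 g
    rcases Int.units_eq_one_or u with rfl | rfl
    · simp
    · change twoSidedHom n g.swap = frakInv n * twoSidedHom n g * (frakInv n)⁻¹
      rw [eq_mul_inv_iff_mul_eq, frakInv_conj_twoSidedHom]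

noncomputable instance (n : ℕ) : MulAction Wreath (FrakSet n) :=
  MulAction.compHom _ (wreathHom n)

theorem wreath_smul_one {n : ℕ} (q p : DihedralGroup 3) (A : FrakSet n) :
    (((⟨(q, p), 1⟩ : Wreath) • A : FrakSet n) : Matrix (Fin 2) (Fin 2) (ZMod n)) =
      modRep n q * A.1 * modRep n p⁻¹ :=
  rfl

theorem wreath_smul_neg_one {n : ℕ} (q p : DihedralGroup 3) (A : FrakSet n) :
    (((⟨(q, p), -1⟩ : Wreath) • A : FrakSet n) : Matrix (Fin 2) (Fin 2) (ZMod n)) =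
      modRep n q * A.1⁻¹ * modRep n p⁻¹ :=
  rfl

theorem Theta_eq_card_orbits (n : ℕ) :
    Theta n = Nat.card (MulAction.orbitRel.Quotient Wreath (FrakSet n)) := by
  refine Nat.card_congr (Quot.congrRight fun A B => ?_)
  rw [MulAction.orbitRel_apply, ← MulAction.mem_orbit_symm, BRel, Sgrp_eq_range]
  constructor
  · rintro ⟨_, _, ⟨p, rfl⟩, ⟨q, rfl⟩, h | h⟩
    · exact ⟨⟨(q, p⁻¹), 1⟩, Subtype.ext (by rw [wreath_smul_one, h, inv_inv])⟩
    · exact ⟨⟨(q, p⁻¹), -1⟩, Subtype.ext (by rw [wreath_smul_neg_one, h, inv_inv])⟩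
  · rintro ⟨⟨⟨q, p⟩, u⟩, rfl⟩
    refine ⟨_, _, ⟨p⁻¹, rfl⟩, ⟨q, rfl⟩, ?_⟩
    rcases Int.units_eq_one_or u with rfl | rfl
    · exact .inl (wreath_smul_one q p A)
    · exact .inr (wreath_smul_neg_one q p A)

end Action

section FixedPoints

open DihedralGroup MulAction

theorem natCard_fixedBy_conj {G X : Type*} [Group G] [MulAction G X] (h g : G) :
    Nat.card (fixedBy X (h * g * h⁻¹)) = Nat.card (fixedBy X g) :=
  (Nat.card_congr ((toPerm h).subtypeEquiv fun x => by
    simp [mem_fixedBy, mul_smul])).symm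

theorem natCard_subtype_frakSet (n : ℕ) (P : Matrix (Fin 2) (Fin 2) (ZMod n) → Prop) :
    Nat.card {A : FrakSet n // P A} = Nat.card {A // Frak n A ∧ P A} :=
  Nat.card_congr (Equiv.subtypeSubtypeEquivSubtypeInter _ _)

theorem mul_modRep_inv_eq_iff {n : ℕ} (p : DihedralGroup 3)
    (A B : Matrix (Fin 2) (Fin 2) (ZMod n)) : A * modRep n p⁻¹ = B ↔ A = B * modRep n p := by
  rw [map_inv, Units.mul_inv_eq_iff_eq_mul]

theorem mem_fixedBy_one_iff {n : ℕ} (q p : DihedralGroup 3) (A : FrakSet n) :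
    A ∈ fixedBy (FrakSet n) (⟨(q, p), 1⟩ : Wreath) ↔ modRep n q * A.1 = A.1 * modRep n p := by
  rw [mem_fixedBy, Subtype.ext_iff, wreath_smul_one, mul_modRep_inv_eq_iff]

theorem mem_fixedBy_neg_one_iff {n : ℕ} (d : DihedralGroup 3) (A : FrakSet n) :
    A ∈ fixedBy (FrakSet n) (⟨(1, d), -1⟩ : Wreath) ↔ A.1 * A.1 = modRep n d⁻¹ := by
  have hdet := A.2.isUnit_det
  rw [mem_fixedBy, Subtype.ext_iff, wreath_smul_neg_one, map_one, Units.val_one, Matrix.one_mul]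
  constructor
  · intro h
    nth_rw 2 [← h]
    rw [Matrix.mul_nonsing_inv_cancel_left _ _ hdet]
  · intro h
    rw [← h, Matrix.nonsing_inv_mul_cancel_left _ _ hdet]

theorem isEmpty_fixedBy_of_pow {n : ℕ} (hn : 1 < n) {q p : DihedralGroup 3} (m : ℕ)
    (h : ¬(q ^ m = 1 ↔ p ^ m = 1)) : IsEmpty (fixedBy (FrakSet n) (⟨(q, p), 1⟩ : Wreath)) := by
  refine ⟨fun ⟨A, hA⟩ => h ?_⟩
  rw [mem_fixedBy_one_iff] at hA
  obtain ⟨U, hU⟩ := (Matrix.isUnit_iff_isUnit_det _).2 A.2.isUnit_det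
  have hU' : modRep n q = U * modRep n p * U⁻¹ := by
    rw [eq_mul_inv_iff_mul_eq]
    exact Units.ext (by simpa [hU] using hA)
  rw [← map_eq_one_iff _ (modRep_injective hn), ← map_eq_one_iff (modRep n) (modRep_injective hn),
    map_pow, map_pow, hU', conj_pow, conj_eq_one_iff]

theorem isEmpty_fixedBy_sr_zero {n : ℕ} (hn : 1 < n) :
    IsEmpty (fixedBy (FrakSet n) (⟨(sr 0, sr 0), 1⟩ : Wreath)) := by
  have : Fact (1 < n) := ⟨hn⟩
  refine ⟨fun ⟨A, hA⟩ => ?_⟩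
  rw [mem_fixedBy_one_iff, coe_modRep_sr_zero] at hA
  have h0 := congrFun₂ hA 0 0
  have h1 := congrFun₂ hA 0 1
  simp only [Matrix.mul_apply, Fin.sum_univ_two, Matrix.of_apply, Matrix.cons_val_zero,
    Matrix.cons_val_one, Matrix.cons_val', Matrix.cons_val_fin_one] at h0 h1
  have h := A.2.2.2.2.2.2.2.2.2.2
  rw [show A.1 0 0 + A.1 0 1 - A.1 1 0 - A.1 1 1 = 0 by linear_combination - h0 - h1] at h
  exact not_isUnit_zero h

theorem isEmpty_fixedBy_neg_one_sr_zero {n : ℕ} (hn : 1 < n) :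
    IsEmpty (fixedBy (FrakSet n) (⟨(1, sr 0), -1⟩ : Wreath)) := by
  refine ⟨fun ⟨A, hA⟩ => (isEmpty_fixedBy_sr_zero hn).false ⟨A, ?_⟩⟩
  rw [mem_fixedBy_neg_one_iff, inv_sr] at hA
  rw [mem_fixedBy_one_iff, ← hA, Matrix.mul_assoc]

theorem natCard_fixedBy_one (n : ℕ) :
    Nat.card (fixedBy (FrakSet n) (⟨(1, 1), 1⟩ : Wreath)) = Nat.card (FrakSet n) := by
  refine Nat.card_congr (Equiv.subtypeUnivEquiv fun A => ?_)
  rw [mem_fixedBy_one_iff, map_one, Units.val_one, Matrix.one_mul, Matrix.mul_one]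

theorem commute_r_one_iff {n : ℕ} {a b c d : ZMod n} :
    !![-1, 1; -1, 0] * !![a, b; c, d] = !![a, b; c, d] * !![-1, 1; -1, 0] ↔
      a = d - b ∧ c = -b := by
  simp only [Matrix.mul_fin_two, ← Matrix.ext_iff, Fin.forall_fin_two, Matrix.of_apply,
    Matrix.cons_val_zero, Matrix.cons_val_one, Matrix.cons_val', Matrix.cons_val_fin_one]
  constructor
  · rintro ⟨⟨h1, h2⟩, h3, h4⟩
    exact ⟨by linear_combination -h2, by linear_combination h1⟩
  · rintro ⟨rfl, rfl⟩
    refine ⟨⟨?_, ?_⟩, ?_, ?_⟩ <;> ring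

theorem frak_eisenstein_iff {n : ℕ} {x y : ZMod n} :
    Frak n !![x - y, y; -y, x] ↔ IsUnit (x * y * (x - y) * (x ^ 2 - x * y + y ^ 2)) := by
  rw [frak_of, show (x - y) * x - y * -y = x ^ 2 - x * y + y ^ 2 by ring,
    show x - y + y = x by ring,
    show -y + x = x - y by ring, show x - y - -y = x by ring, show y - x = -(x - y) by ring,
    show x - -y - x = y by ring]
  simp only [IsUnit.neg_iff, IsUnit.mul_iff]
  tauto

theorem natCard_fixedBy_r_one (n : ℕ) :
    Nat.card (fixedBy (FrakSet n) (⟨(r 1, r 1), 1⟩ : Wreath)) =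
      Nat.card {v : Fin 2 → ZMod n //
        IsUnit (v 0 * v 1 * (v 0 - v 1) * (v 0 ^ 2 - v 0 * v 1 + v 1 ^ 2))} := by
  rw [Nat.card_congr (Equiv.subtypeEquivRight (mem_fixedBy_one_iff (n := n) (r 1) (r 1))),
    coe_modRep_r_one, natCard_subtype_frakSet n fun A =>
      !![-1, 1; -1, 0] * A = A * !![-1, 1; -1, 0]]
  refine Nat.card_congr
    { toFun := fun A => ⟨![A.1 1 1, A.1 0 1], ?_⟩
      invFun := fun v => ⟨!![v.1 0 - v.1 1, v.1 1; -v.1 1, v.1 0],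
        frak_eisenstein_iff.2 v.2, commute_r_one_iff.2 ⟨rfl, rfl⟩⟩
      left_inv := fun A => ?_
      right_inv := fun v => ?_ }
  · obtain ⟨A, hA, hc⟩ := A
    rw [Matrix.eta_fin_two A] at hA hc
    obtain ⟨h1, h2⟩ := commute_r_one_iff.1 hc
    rw [h1, h2] at hA
    exact frak_eisenstein_iff.1 hA
  · obtain ⟨A, hA, hc⟩ := A
    rw [Matrix.eta_fin_two A] at hc
    obtain ⟨h1, h2⟩ := commute_r_one_iff.1 hc
    refine Subtype.ext (Eq.trans ?_ (Matrix.eta_fin_two A).symm)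
    rw [h1, h2]
    rfl
  · exact Subtype.ext (funext (Fin.forall_fin_two.2 ⟨rfl, rfl⟩))

theorem frak_mul_self_eq_one_iff {n : ℕ} {a b c d : ZMod n} :
    Frak n !![a, b; c, d] ∧ !![a, b; c, d] * !![a, b; c, d] = 1 ↔
      d = -a ∧ b * c = 1 - a ^ 2 ∧
        IsUnit (a * (a + b) * (a - (a + b)) * (1 - a ^ 2) * (1 - (a + b) ^ 2) *
          (1 - a * (a + b))) := by
  rw [frak_of, Matrix.mul_fin_two, Matrix.one_fin_two]
  simp only [← Matrix.ext_iff, Fin.forall_fin_two, Matrix.of_apply,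
    Matrix.cons_val_zero, Matrix.cons_val_one, Matrix.cons_val', Matrix.cons_val_fin_one]
  constructor
  · rintro ⟨⟨h1, ha, hb, hc, hd, hab, hcd, hac, hbd, habcd⟩, ⟨e1, e2⟩, -, -⟩
    obtain rfl : d = -a := by
      have : b * (a + d) = 0 := by linear_combination e2
      linear_combination hb.mul_right_eq_zero.1 this
    have hbc : b * c = 1 - a ^ 2 := by linear_combination e1
    refine ⟨rfl, hbc, ?_⟩
    simp only [IsUnit.mul_iff]
    refine ⟨⟨⟨⟨⟨ha, hab⟩, ?_⟩, hbc ▸ hb.mul hc⟩, ?_⟩, ?_⟩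
    · convert hb.neg using 1; ring
    · convert (hb.mul habcd).neg using 1
      linear_combination -hbc
    · convert (hb.mul hac).neg using 1
      linear_combination -hbc
  · rintro ⟨rfl, hbc, h⟩
    simp only [IsUnit.mul_iff] at h
    obtain ⟨⟨⟨⟨⟨ha, hab⟩, hb⟩, h1⟩, h2⟩, h3⟩ := h
    replace hb : IsUnit b := by
      convert hb.neg using 1
      ring
    have hac : IsUnit (a - c) := by
      refine isUnit_of_mul_isUnit_right (x := b) ?_
      convert h3.neg using 1
      linear_combination -hbc
    have habcd : IsUnit (a + b - c - -a) := by
      refine isUnit_of_mul_isUnit_right (x := b) ?_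
      convert h2.neg using 1
      linear_combination -hbc
    refine ⟨⟨?_, ha, hb, ?_, ha.neg, hab, ?_, hac, ?_, habcd⟩, ⟨?_, ?_⟩, ?_, ?_⟩
    · convert (isUnit_one (M := ZMod n)).neg using 1
      linear_combination -hbc
    · exact isUnit_of_mul_isUnit_right (hbc ▸ h1)
    · convert hac.neg using 1; ring
    · convert hab using 1; ring
    all_goals first | linear_combination hbc | ring

theorem natCard_fixedBy_neg_one_one (n : ℕ) :
    Nat.card (fixedBy (FrakSet n) (⟨(1, 1), -1⟩ : Wreath)) =
      Nat.card {v : Fin 2 → ZMod n //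
        IsUnit (v 0 * v 1 * (v 0 - v 1) * (1 - v 0 ^ 2) * (1 - v 1 ^ 2) * (1 - v 0 * v 1))} := by
  rw [Nat.card_congr (Equiv.subtypeEquivRight (mem_fixedBy_neg_one_iff (n := n) 1)),
    natCard_subtype_frakSet n fun A => A * A = modRep n 1⁻¹, inv_one, map_one, Units.val_one]
  have key (A : {A : Matrix (Fin 2) (Fin 2) (ZMod n) // Frak n A ∧ A * A = 1}) :=
    (frak_mul_self_eq_one_iff (a := A.1 0 0) (b := A.1 0 1) (c := A.1 1 0) (d := A.1 1 1)).1
      (by simpa only [← Matrix.eta_fin_two] using A.2)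
  refine Nat.card_eq_of_bijective
    (fun A => ⟨![A.1 0 0, A.1 0 0 + A.1 0 1], (key A).2.2⟩) ⟨fun A B hAB => ?_, fun v => ?_⟩
  · have h := Subtype.ext_iff.1 hAB
    have h0 : A.1 0 0 = B.1 0 0 := congrFun h 0
    have h1 : A.1 0 1 = B.1 0 1 := by
      have : A.1 0 0 + A.1 0 1 = B.1 0 0 + B.1 0 1 := congrFun h 1
      linear_combination this - h0
    have h2 : A.1 1 0 = B.1 1 0 := by
      refine A.2.1.2.2.1.mul_left_cancel ?_
      rw [(key A).2.1, h1, (key B).2.1, h0]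
    have h3 : A.1 1 1 = B.1 1 1 := by
      rw [(key A).1, (key B).1, h0]
    exact Subtype.ext (Matrix.ext (Fin.forall_fin_two.2
      ⟨Fin.forall_fin_two.2 ⟨h0, h1⟩, Fin.forall_fin_two.2 ⟨h2, h3⟩⟩))
  · obtain ⟨v, hv⟩ := v
    have hu : IsUnit (v 1 - v 0) := by
      simp only [IsUnit.mul_iff] at hv
      convert hv.1.1.1.2.neg using 1
      ring
    obtain ⟨u, hu⟩ := hu
    refine ⟨⟨!![v 0, v 1 - v 0; ↑u⁻¹ * (1 - v 0 ^ 2), -v 0],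
      frak_mul_self_eq_one_iff.2 ⟨rfl, ?_, ?_⟩⟩,
      Subtype.ext (funext (Fin.forall_fin_two.2 ⟨rfl, ?_⟩))⟩
    · rw [← hu, Units.mul_inv_cancel_left]
    · rwa [add_sub_cancel]
    · exact add_sub_cancel (v 0) (v 1)

theorem frak_mul_self_eq_r_one_iff {n : ℕ} {a b c d : ZMod n} (h2 : IsUnit (2 : ZMod n)) :
    Frak n !![a, b; c, d] ∧ !![a, b; c, d] * !![a, b; c, d] = !![-1, 1; -1, 0] ↔
      a = -2 * b ∧ c = -b ∧ d = -b ∧ 3 * b ^ 2 = -1 := by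
  constructor
  · rintro ⟨hF, hsq⟩
    have hcomm := (commute_r_one_iff (a := a) (b := b) (c := c) (d := d)).1
      (by rw [← hsq, Matrix.mul_assoc])
    obtain ⟨rfl, rfl⟩ := hcomm
    rw [Matrix.mul_fin_two] at hsq
    simp only [← Matrix.ext_iff, Fin.forall_fin_two, Matrix.of_apply,
      Matrix.cons_val_zero, Matrix.cons_val_one, Matrix.cons_val', Matrix.cons_val_fin_one] at hsq
    obtain ⟨⟨e1, e2⟩, e3, e4⟩ := hsq
    obtain rfl : d = -b := by
      have : (d - b) * (d + b) = 0 := by linear_combination e4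
      linear_combination hF.2.1.mul_right_eq_zero.1 this
    exact ⟨by ring, rfl, rfl, by linear_combination -e2⟩
  · rintro ⟨rfl, rfl, rfl, h⟩
    have hb : IsUnit b := .of_mul_eq_one (-3 * b) (by linear_combination -h)
    have h2b : IsUnit (2 * b) := h2.mul hb
    rw [Matrix.mul_fin_two, frak_of]
    refine ⟨⟨?_, ?_, hb, hb.neg, hb.neg, ?_, ?_, ?_, ?_, ?_⟩, ?_⟩
    · convert (isUnit_one (M := ZMod n)).neg using 1
      linear_combination h
    · convert h2b.neg using 1; ring
    · convert hb.neg using 1; ring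
    · convert h2b.neg using 1; ring
    · convert hb.neg using 1; ring
    · convert h2b using 1; ring
    · convert hb using 1; ring
    · simp only [← Matrix.ext_iff, Fin.forall_fin_two, Matrix.of_apply, Matrix.cons_val_zero,
        Matrix.cons_val_one, Matrix.cons_val', Matrix.cons_val_fin_one]
      refine ⟨⟨?_, ?_⟩, ?_, ?_⟩
      · linear_combination h
      · linear_combination -h
      · linear_combination h
      · ring

theorem natCard_fixedBy_neg_one_r_two {n : ℕ} (h2 : IsUnit (2 : ZMod n))
    (h3 : IsUnit (3 : ZMod n)) :
    Nat.card (fixedBy (FrakSet n) (⟨(1, r 2), -1⟩ : Wreath)) =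
      Nat.card {t : ZMod n // t ^ 2 - t + 1 = 0} := by
  rw [Nat.card_congr (Equiv.subtypeEquivRight (mem_fixedBy_neg_one_iff (n := n) (r 2))),
    natCard_subtype_frakSet n fun A => A * A = modRep n (r 2)⁻¹,
    show (r 2)⁻¹ = (r 1 : DihedralGroup 3) from rfl, coe_modRep_r_one]
  obtain ⟨u, hu⟩ := h2
  obtain ⟨w, hw⟩ := h3
  have hu' : (2 : ZMod n) * ↑u⁻¹ = 1 := by rw [← hu, Units.mul_inv]
  have hw' : (3 : ZMod n) * ↑w⁻¹ = 1 := by rw [← hw, Units.mul_inv]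
  have key (A : {A : Matrix (Fin 2) (Fin 2) (ZMod n) // Frak n A ∧ A * A = !![-1, 1; -1, 0]}) :=
    (frak_mul_self_eq_r_one_iff (a := A.1 0 0) (b := A.1 0 1) (c := A.1 1 0) (d := A.1 1 1)
      ⟨u, hu⟩).1 (by simpa only [← Matrix.eta_fin_two] using A.2)
  refine Nat.card_eq_of_bijective
    (fun A => ⟨(1 + 3 * A.1 0 1) * ↑u⁻¹, ?_⟩) ⟨fun A B hAB => ?_, fun t => ?_⟩
  · obtain ⟨-, -, -, h⟩ := key A
    refine (u.isUnit.pow 2).mul_left_cancel ?_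
    rw [hu]
    linear_combination 3 * h +
      ((1 + 3 * A.1 0 1) ^ 2 * (2 * ↑u⁻¹ + 1) - 2 * (1 + 3 * A.1 0 1)) * hu'
  · have h : (1 + 3 * A.1 0 1) * ↑u⁻¹ = (1 + 3 * B.1 0 1) * ↑u⁻¹ := Subtype.ext_iff.1 hAB
    have h1 : A.1 0 1 = B.1 0 1 := w.isUnit.mul_left_cancel
      (by rw [hw]; exact add_left_cancel (u⁻¹.isUnit.mul_right_cancel h))
    obtain ⟨ha, hc, hd, -⟩ := key A
    obtain ⟨ha', hc', hd', -⟩ := key B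
    exact Subtype.ext (Matrix.ext (Fin.forall_fin_two.2
      ⟨Fin.forall_fin_two.2 ⟨by rw [ha, ha', h1], h1⟩,
        Fin.forall_fin_two.2 ⟨by rw [hc, hc', h1], by rw [hd, hd', h1]⟩⟩))
  · obtain ⟨t, ht⟩ := t
    refine ⟨⟨!![_, (2 * t - 1) * ↑w⁻¹; _, _],
      (frak_mul_self_eq_r_one_iff ⟨u, hu⟩).2 ⟨rfl, rfl, rfl, ?_⟩⟩, Subtype.ext ?_⟩
    · refine w.isUnit.mul_left_cancel ?_
      rw [hw]
      linear_combination 4 * ht + (2 * t - 1) ^ 2 * (3 * ↑w⁻¹ + 1) * hw'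
    · change (1 + 3 * ((2 * t - 1) * ↑w⁻¹)) * ↑u⁻¹ = t
      linear_combination (2 * t - 1) * ↑u⁻¹ * hw' + t * hu'

theorem DihedralGroup.three_conj_cases (d : DihedralGroup 3) :
    d = 1 ∨ ((d ≠ 1 ∧ d ^ 3 = 1) ∧ (∃ h, d = h * r 1 * h⁻¹) ∧ ∃ h, d = h * r 2 * h⁻¹) ∨
      ((d ≠ 1 ∧ d ^ 3 ≠ 1) ∧ ∃ h, d = h * sr 0 * h⁻¹) := by
  revert d
  decide

theorem natCard_fixedBy_pos {n : ℕ} (hn : 1 < n) (q p : DihedralGroup 3) :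
    Nat.card (fixedBy (FrakSet n) (⟨(q, p), 1⟩ : Wreath)) =
      (if q = 1 ∧ p = 1 then Nat.card (FrakSet n) else 0) +
      (if (q ≠ 1 ∧ q ^ 3 = 1) ∧ p ≠ 1 ∧ p ^ 3 = 1 then
        Nat.card (fixedBy (FrakSet n) (⟨(r 1, r 1), 1⟩ : Wreath)) else 0) := by
  have conj (h k a b : DihedralGroup 3) :
      Nat.card (fixedBy (FrakSet n) (⟨(h * a * h⁻¹, k * b * k⁻¹), 1⟩ : Wreath)) =
        Nat.card (fixedBy (FrakSet n) (⟨(a, b), 1⟩ : Wreath)) :=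
    natCard_fixedBy_conj (⟨(h, k), 1⟩ : Wreath) ⟨(a, b), 1⟩
  have empty (m : ℕ) (h : ¬(q ^ m = 1 ↔ p ^ m = 1)) :
      Nat.card (fixedBy (FrakSet n) (⟨(q, p), 1⟩ : Wreath)) = 0 :=
    have := isEmpty_fixedBy_of_pow hn m h
    Nat.card_of_isEmpty
  rcases three_conj_cases q with hq | ⟨hq, ⟨h, hh⟩, -⟩ | ⟨hq, h, hh⟩ <;>
    rcases three_conj_cases p with hp | ⟨hp, ⟨k, hk⟩, -⟩ | ⟨hp, k, hk⟩
  · subst hq hp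
    rw [if_pos ⟨rfl, rfl⟩, if_neg (by simp), natCard_fixedBy_one, add_zero]
  · rw [empty 1 (by simp [hq, hp])]
    simp [hq, hp]
  · rw [empty 1 (by simp [hq, hp])]
    simp [hq, hp]
  · rw [empty 1 (by simp [hq, hp])]
    simp [hq, hp]
  · rw [if_neg (by simp [hq]), if_pos ⟨hq, hp⟩, zero_add, hh, hk, conj]
  · rw [empty 3 (by simp [hq, hp])]
    simp [hq, hp]
  · rw [empty 1 (by simp [hq, hp])]
    simp [hq, hp]
  · rw [empty 3 (by simp [hq, hp])]
    simp [hq, hp]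
  · have := isEmpty_fixedBy_sr_zero hn
    rw [if_neg (by simp [hq]), if_neg (by simp [hq]), hh, hk, conj, Nat.card_of_isEmpty]

theorem natCard_fixedBy_neg {n : ℕ} (hn : 1 < n) (q p : DihedralGroup 3) :
    Nat.card (fixedBy (FrakSet n) (⟨(q, p), -1⟩ : Wreath)) =
      (if p * q = 1 then Nat.card (fixedBy (FrakSet n) (⟨(1, 1), -1⟩ : Wreath)) else 0) +
      (if p * q ≠ 1 ∧ (p * q) ^ 3 = 1 then
        Nat.card (fixedBy (FrakSet n) (⟨(1, r 2), -1⟩ : Wreath)) else 0) := by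
  have conj (h d : DihedralGroup 3) :
      Nat.card (fixedBy (FrakSet n) (⟨(1, h * d * h⁻¹), -1⟩ : Wreath)) =
        Nat.card (fixedBy (FrakSet n) (⟨(1, d), -1⟩ : Wreath)) := by
    rw [← natCard_fixedBy_conj (⟨(h, h), 1⟩ : Wreath) ⟨(1, d), -1⟩]
    congr 3
    refine SemidirectProduct.ext (Prod.ext ?_ rfl) rfl
    exact ((congrArg (· * h⁻¹) (mul_one h)).trans (mul_inv_cancel h)).symm
  have hpq : Nat.card (fixedBy (FrakSet n) (⟨(q, p), -1⟩ : Wreath)) =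
      Nat.card (fixedBy (FrakSet n) (⟨(1, p * q), -1⟩ : Wreath)) := by
    rw [← natCard_fixedBy_conj (⟨(q, 1), 1⟩ : Wreath) ⟨(1, p * q), -1⟩]
    congr 3
    refine SemidirectProduct.ext (Prod.ext ?_ ?_) rfl
    · change q = q * 1 * 1⁻¹
      simp
    · change p = 1 * (p * q) * q⁻¹
      simp
  rw [hpq]
  rcases three_conj_cases (p * q) with hd | ⟨hd, -, h, hh⟩ | ⟨hd, h, hh⟩
  · simp [hd]
  · rw [if_neg hd.1, if_pos hd, zero_add, hh, conj]
  · have := isEmpty_fixedBy_neg_one_sr_zero hn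
    rw [if_neg hd.1, if_neg (by simp [hd]), hh, conj, Nat.card_of_isEmpty]

theorem sum_sum_ite {α β : Type*} [Fintype α] [Fintype β] (P : α → β → Prop)
    [∀ a b, Decidable (P a b)] (c : ℕ) :
    ∑ a, ∑ b, (if P a b then c else 0) = Finset.card {x : α × β | P x.1 x.2} * c := by
  rw [← Fintype.sum_prod_type', ← Finset.sum_filter, Finset.sum_const, smul_eq_mul]

theorem mul_Theta_eq_sum_natCard_fixedBy {n : ℕ} (hn : 1 < n) :
    72 * Theta n = Nat.card (FrakSet n) +
      4 * Nat.card (fixedBy (FrakSet n) (⟨(r 1, r 1), 1⟩ : Wreath)) +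
      6 * Nat.card (fixedBy (FrakSet n) (⟨(1, 1), -1⟩ : Wreath)) +
      12 * Nat.card (fixedBy (FrakSet n) (⟨(1, r 2), -1⟩ : Wreath)) := by
  have : NeZero n := ⟨by omega⟩
  let e : Wreath ≃ (DihedralGroup 3 × DihedralGroup 3) × ℤˣ := SemidirectProduct.equivProd
  let : Fintype Wreath := Fintype.ofEquiv _ e.symm
  have : Finite (FrakSet n) := Subtype.finite
  have := Fintype.ofFinite (FrakSet n)
  have (g : Wreath) := Fintype.ofFinite (fixedBy (FrakSet n) g)
  have := Fintype.ofFinite (orbitRel.Quotient Wreath (FrakSet n))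
  have hcard : Fintype.card Wreath = 72 := (Fintype.card_congr e).trans (by decide)
  have burnside := sum_card_fixedBy_eq_card_orbits_mul_card_group Wreath (FrakSet n)
  simp only [← Nat.card_eq_fintype_card (α := fixedBy _ _)] at burnside
  rw [hcard, ← Nat.card_eq_fintype_card, ← Theta_eq_card_orbits, mul_comm,
    ← e.symm.sum_comp, Fintype.sum_prod_type, Fintype.sum_prod_type] at burnside
  have hsum (q p : DihedralGroup 3) :
      ∑ u : ℤˣ, Nat.card (fixedBy (FrakSet n) (e.symm ((q, p), u))) =
      _ := (Finset.sum_pair (by decide)).trans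
        (congrArg₂ _ (natCard_fixedBy_pos hn q p) (natCard_fixedBy_neg hn q p))
  simp only [hsum, Finset.sum_add_distrib] at burnside
  rw [← burnside, sum_sum_ite fun q p => q = 1 ∧ p = 1,
    sum_sum_ite fun q p => (q ≠ 1 ∧ q ^ 3 = 1) ∧ p ≠ 1 ∧ p ^ 3 = 1,
    sum_sum_ite fun q p => p * q = 1, sum_sum_ite fun q p => p * q ≠ 1 ∧ (p * q) ^ 3 = 1,
    show Finset.card {x : DihedralGroup 3 × DihedralGroup 3 | x.1 = 1 ∧ x.2 = 1} = 1 by decide,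
    show Finset.card {x : DihedralGroup 3 × DihedralGroup 3 |
      (x.1 ≠ 1 ∧ x.1 ^ 3 = 1) ∧ x.2 ≠ 1 ∧ x.2 ^ 3 = 1} = 4 by decide,
    show Finset.card {x : DihedralGroup 3 × DihedralGroup 3 | x.2 * x.1 = 1} = 6 by decide,
    show Finset.card {x : DihedralGroup 3 × DihedralGroup 3 |
      x.2 * x.1 ≠ 1 ∧ (x.2 * x.1) ^ 3 = 1} = 12 by decide]
  ring

end FixedPoints

/-- For `n > 1` coprime to `6`,
`72·Θ(n) = |𝔉ₙ| + 4·∏ θ₂(pᵢ,eᵢ) + 6·∏ pᵢ^{2eᵢ-2}(pᵢ-3)(pᵢ-5) + 12·∏ θ₄(pᵢ)`,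
the products ranging over the distinct primes `pᵢ` dividing `n` with multiplicities `eᵢ`. -/
theorem theta_formula (n : ℕ) (hn : 1 < n) (h6 : Nat.Coprime n 6) :
    72 * Theta n =
      Nat.card {A : Matrix (Fin 2) (Fin 2) (ZMod n) // Frak n A}
      + 4 * ∏ p ∈ n.primeFactors,
          (if p % 3 = 1 then p ^ (2 * n.factorization p - 2) * (p - 1) * (p - 4)
            else p ^ (2 * n.factorization p - 2) * (p - 1) * (p - 2))
      + 6 * ∏ p ∈ n.primeFactors, p ^ (2 * n.factorization p - 2) * (p - 3) * (p - 5)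
      + 12 * ∏ p ∈ n.primeFactors, (if p % 3 = 1 then 2 else 0) := by
  have hn0 : n ≠ 0 := by omega
  have h2 : IsUnit (2 : ZMod n) := by
    exact_mod_cast (ZMod.isUnit_iff_coprime 2 n).2 (h6.symm.coprime_dvd_left (by norm_num))
  have h3 : IsUnit (3 : ZMod n) := by
    exact_mod_cast (ZMod.isUnit_iff_coprime 3 n).2 (h6.symm.coprime_dvd_left (by norm_num))
  rw [mul_Theta_eq_sum_natCard_fixedBy hn, natCard_fixedBy_neg_one_r_two h2 h3,
    ZMod.natCard_roots hn0 h6, natCard_fixedBy_r_one, natCard_fixedBy_neg_one_one]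
  congr 4
  · have h := ZMod.natCard_isUnit_aeval
      (.X 0 * .X 1 * (.X 0 - .X 1) * (.X 0 ^ 2 - .X 0 * .X 1 + .X 1 ^ 2)) hn0
    simp only [map_mul, map_sub, map_add, map_pow, MvPolynomial.aeval_X] at h
    rw [h]
    refine Finset.prod_congr rfl fun p hp => ?_
    have : Fact p.Prime := ⟨Nat.prime_of_mem_primeFactors hp⟩
    have hroots : Nat.card {t : ZMod p // t ^ 2 - t + 1 = 0} = if p % 3 = 1 then 2 else 0 := by
      have := ZMod.natCard_roots_prime_pow (p := p) Fact.out
        (Nat.five_le_of_mem_primeFactors h6 hp) one_ne_zero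
      rwa [pow_one] at this
    rw [natCard_pairs_eisenstein hroots, Nat.card_zmod]
    split_ifs <;> ring
  · have h := ZMod.natCard_isUnit_aeval
      (.X 0 * .X 1 * (.X 0 - .X 1) * (1 - .X 0 ^ 2) * (1 - .X 1 ^ 2) * (1 - .X 0 * .X 1)) hn0
    simp only [map_mul, map_sub, map_one, map_pow, MvPolynomial.aeval_X] at h
    rw [h]
    refine Finset.prod_congr rfl fun p hp => ?_
    have : Fact p.Prime := ⟨Nat.prime_of_mem_primeFactors hp⟩
    have h5 := Nat.five_le_of_mem_primeFactors h6 hp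
    have h2 : (2 : ZMod p) ≠ 0 := by
      exact_mod_cast ZMod.natCast_ne_zero_of_lt (p := p) (m := 2) (by omega) (by omega)
    rw [natCard_pairs_involution h2, Nat.card_zmod, mul_assoc]
end
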